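/- For every positive integer k there exists Q such that for every prime power q ≥ Q the following holds, where d = (k+1)^2 + 1 and n = q^{k+1}: there exists a bipartite graph G(A,B) with |A| = |B| = n such that every k-element subset of A has at least q/2 common neighbours in B, and every (k+1)-element subset of A has at most d^{k+1} common neighbours in B. -/

import Mathlib

namespace S6
set_option linter.unusedSectionVars false
open MvPolynomial

def Gen {σ K : Type*} [Field K] (S : Finset σ) (p : Ideal (MvPolynomial σ K)) : Prop :=
  ∀ f ∈ p, f.vars ⊆ S → f = 0

section chain
variable {σ K : Type*} [Field K] [Fintype σ] [DecidableEq σ]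

lemma gen_algInd {S : Finset σ} {p : Ideal (MvPolynomial σ K)} (h : Gen S p) :
    AlgebraicIndependent K (fun s : S => Ideal.Quotient.mk p (X (s : σ))) := by
  rw [algebraicIndependent_iff]
  intro g hg
  have h1 : (aeval fun s : S => Ideal.Quotient.mk p (X (s : σ))) g
      = Ideal.Quotient.mk p (rename (fun s : S => (s : σ)) g) := by
    have : (aeval fun s : S => Ideal.Quotient.mk p (X (s : σ)))
        = (Ideal.Quotient.mkₐ K p).comp (rename (fun s : S => (s : σ))) := by
      ext j : 1
      simp
    rw [this]; simp
  rw [h1, Ideal.Quotient.eq_zero_iff_mem] at hg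
  have h2 := h _ hg (by
    intro x hx
    have := vars_rename _ _ hx
    simp only [Finset.mem_image] at this
    obtain ⟨y, _, rfl⟩ := this
    exact y.2)
  exact (rename_injective _ Subtype.val_injective) (by simpa using h2)

/-- partial specialisation. -/
noncomputable def spec (p : Ideal (MvPolynomial σ K)) (T : Finset σ) :
    MvPolynomial σ K →ₐ[K] MvPolynomial σ (MvPolynomial σ K ⧸ p) :=
  aeval fun i => if i ∈ T then C (Ideal.Quotient.mk p (X i)) else X i

lemma spec_insert (p : Ideal (MvPolynomial σ K)) (T : Finset σ) (i : σ) (f : MvPolynomial σ K)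
    (hf : spec p T f = 0) : spec p (insert i T) f = 0 := by
  have : spec p (insert i T) = ((aeval fun j => if j = i then C (Ideal.Quotient.mk p (X i)) else X j :
      MvPolynomial σ (MvPolynomial σ K ⧸ p) →ₐ[MvPolynomial σ K ⧸ p] _).restrictScalars K).comp
        (spec p T) := by
    ext j : 1
    simp only [spec, aeval_X, AlgHom.comp_apply, AlgHom.restrictScalars_apply]
    by_cases hj : j = i
    · subst hj
      by_cases hT : j ∈ T <;> simp [hT, algebraMap_eq]
    · by_cases hT : j ∈ T <;> simp [hT, hj, algebraMap_eq]
  rw [this, AlgHom.comp_apply, hf, map_zero]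

lemma spec_mem (p : Ideal (MvPolynomial σ K)) (T : Finset σ) (f : MvPolynomial σ K)
    (hv : f.vars ⊆ T) (hf : f ∈ p) : spec p T f = 0 := by
  have h1 : spec p T f = aeval (fun i => C (Ideal.Quotient.mk p (X i))) f := by
    unfold spec
    simp only [aeval_def]
    apply eval₂Hom_congr' rfl _ rfl
    intro i hi _
    rw [if_pos (hv hi)]
  have h2 : (aeval (fun i => (C (Ideal.Quotient.mk p (X i)) : MvPolynomial σ (MvPolynomial σ K ⧸ p))) f)
      = C (Ideal.Quotient.mk p f) := by
    have : (aeval (fun i => (C (Ideal.Quotient.mk p (X i)) : MvPolynomial σ (MvPolynomial σ K ⧸ p))) :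
        MvPolynomial σ K →ₐ[K] _) = (IsScalarTower.toAlgHom K (MvPolynomial σ K ⧸ p) _).comp
          (Ideal.Quotient.mkₐ K p) := by
      ext j : 1
      simp [algebraMap_eq]
    rw [this]; simp [algebraMap_eq]
  rw [h1, h2, Ideal.Quotient.eq_zero_iff_mem.2 hf, map_zero]

lemma spec_ne {S : Finset σ} {p : Ideal (MvPolynomial σ K)} [p.IsPrime] (h : Gen S p)
    (T : Finset σ) (hST : S ⊆ T) (i : σ) (hi : i ∉ T) (f : MvPolynomial σ K)
    (hv : f.vars ⊆ insert i S) (hf : spec p T f = 0) : f = 0 := by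
  have a1 := gen_algInd h
  have a2 : AlgebraicIndependent (MvPolynomial σ K ⧸ p)
      (fun _ : Unit => (X i : MvPolynomial σ (MvPolynomial σ K ⧸ p))) :=
    (algebraicIndependent_X σ (MvPolynomial σ K ⧸ p)).comp (fun _ : Unit => i)
      (fun _ _ _ => rfl)
  have a3 := a1.sumElim_comp a2
  obtain ⟨g, rfl⟩ := exists_rename_eq_of_vars_subset_range f
    (Sum.elim (fun _ : Unit => i) (fun s : S => (s : σ))) (by
      rintro (a | a) (b | b) hab
      · rfl
      · simp at hab; exact absurd (hST b.2) (hab ▸ hi)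
      · simp at hab; exact absurd (hST a.2) (hab ▸ hi)
      · simp at hab; rw [hab]) (by
      intro x hx
      rcases Finset.mem_insert.1 (hv hx) with rfl | hx
      · exact ⟨Sum.inl (), rfl⟩
      · exact ⟨Sum.inr ⟨x, hx⟩, rfl⟩)
  rw [algebraicIndependent_iff] at a3
  rw [a3 g, map_zero]
  rw [← hf, spec, aeval_rename]
  congr 2
  ext1 (a | a)
  · simp [hi]
  · simp [hST a.2, algebraMap_eq]

noncomputable def chI (p : Ideal (MvPolynomial σ K)) (T : Finset σ) :
    Ideal (Polynomial (MvPolynomial σ K)) :=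
  RingHom.ker (Polynomial.mapRingHom (spec p T).toRingHom)

instance chI_prime (p : Ideal (MvPolynomial σ K)) [p.IsPrime] (T : Finset σ) :
    (chI p T).IsPrime := RingHom.ker_isPrime _

lemma chI_height {S : Finset σ} {p : Ideal (MvPolynomial σ K)} [p.IsPrime] (h : Gen S p)
    (h2 : ∀ i ∉ S, ¬ Gen (insert i S) p) (T : Finset σ) (hT : Disjoint S T) :
    (T.card : ℕ∞) ≤ (chI p (S ∪ T)).height := by
  induction T using Finset.induction_on with
  | empty => simp
  | insert i T hi ih =>
    have hiS : i ∉ S := fun hh => Finset.disjoint_left.1 hT hh (Finset.mem_insert_self _ _)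
    have ih := ih (hT.mono_right (Finset.subset_insert _ _))
    have hlt : chI p (S ∪ T) < chI p (S ∪ insert i T) := by
      rw [Finset.union_insert]
      refine lt_of_le_of_ne ?_ ?_
      · intro F hF
        simp only [chI, RingHom.mem_ker, Polynomial.coe_mapRingHom] at hF ⊢
        ext1 n
        have := congrArg (fun G => Polynomial.coeff G n) hF
        simp only [Polynomial.coeff_map, Polynomial.coeff_zero] at this ⊢
        exact spec_insert p _ i _ this
      · intro heq
        have := h2 i hiS
        simp only [Gen, not_forall] at this
        obtain ⟨f, hf, hv, hf0⟩ := this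
        have m1 : Polynomial.C f ∈ chI p (insert i (S ∪ T)) := by
          simp only [chI, RingHom.mem_ker, Polynomial.coe_mapRingHom, Polynomial.map_C]
          have := spec_mem p (insert i (S ∪ T)) f (hv.trans (Finset.insert_subset_insert _
            Finset.subset_union_left)) hf
          simpa using this
        rw [← heq] at m1
        simp only [chI, RingHom.mem_ker, Polynomial.coe_mapRingHom, Polynomial.map_C,
          Polynomial.C_eq_zero] at m1
        exact hf0 (spec_ne h (S ∪ T) Finset.subset_union_left i (by simp [hiS, hi]) f hv m1)
    have := Ideal.height_add_one_le_of_lt_of_isPrime hlt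
    rw [Finset.card_insert_of_notMem hi]
    push_cast
    exact le_trans (by gcongr) this

noncomputable def topI (p : Ideal (MvPolynomial σ K)) : Ideal (Polynomial (MvPolynomial σ K)) :=
  p.comap (Polynomial.evalRingHom 0)

instance topI_prime (p : Ideal (MvPolynomial σ K)) [p.IsPrime] : (topI p).IsPrime :=
  Ideal.comap_isPrime _ _

lemma topI_height {S : Finset σ} {p : Ideal (MvPolynomial σ K)} [p.IsPrime] (h : Gen S p)
    (h2 : ∀ i ∉ S, ¬ Gen (insert i S) p) :
    ((Sᶜ.card + 1 : ℕ) : ℕ∞) ≤ (topI p).height := by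
  have h3 := chI_height h h2 Sᶜ disjoint_compl_right
  have hlt : chI p (S ∪ Sᶜ) < topI p := by
    rw [Finset.union_compl]
    refine lt_of_le_of_ne ?_ ?_
    · intro F hF
      simp only [chI, RingHom.mem_ker, Polynomial.coe_mapRingHom] at hF
      have := congrArg (fun G => Polynomial.coeff G 0) hF
      simp only [Polynomial.coeff_map, Polynomial.coeff_zero] at this
      have h4 : spec p Finset.univ (F.coeff 0) = C (Ideal.Quotient.mk p (F.coeff 0)) := by
        have : spec p Finset.univ = (IsScalarTower.toAlgHom K (MvPolynomial σ K ⧸ p) _).comp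
            (Ideal.Quotient.mkₐ K p) := by
          ext j : 1
          simp [spec, algebraMap_eq]
        rw [this]; simp [algebraMap_eq]
      have h5 : spec p Finset.univ (F.coeff 0) = 0 := this
      rw [h4] at h5
      simp only [C_eq_zero, Ideal.Quotient.eq_zero_iff_mem] at h5
      simpa [topI, Ideal.mem_comap, Polynomial.coeff_zero_eq_eval_zero] using h5
    · intro heq
      have m1 : (Polynomial.X : Polynomial (MvPolynomial σ K)) ∈ topI p := by
        simp [topI, Ideal.mem_comap]
      rw [← heq] at m1
      simp [chI, RingHom.mem_ker] at m1
  have := Ideal.height_add_one_le_of_lt_of_isPrime hlt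
  push_cast
  exact le_trans (by gcongr) this
end chain

section bez
variable {σ K : Type*} [Field K] [Fintype σ] [DecidableEq σ]

lemma incomp {S : Finset σ} {p p' : Ideal (MvPolynomial σ K)} [p.IsPrime] [p'.IsPrime]
    (h : Gen S p) (h2 : ∀ i ∉ S, ¬ Gen (insert i S) p) (h' : Gen S p') (hle : p ≤ p') :
    p = p' := by
  refine le_antisymm hle ?_
  intro f hf
  by_contra hfp
  have a1 := gen_algInd h
  set x : S → MvPolynomial σ K ⧸ p := fun s : S => Ideal.Quotient.mk p (X (s : σ)) with hx
  have hX : ∀ i : σ, IsAlgebraic (Algebra.adjoin K (Set.range x)) (Ideal.Quotient.mk p (X i)) := by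
    intro i
    by_cases hi : i ∈ S
    · have : (Ideal.Quotient.mk p (X i)) ∈ Algebra.adjoin K (Set.range x) :=
        Algebra.subset_adjoin ⟨⟨i, hi⟩, rfl⟩
      exact isAlgebraic_algebraMap (⟨_, this⟩ : Algebra.adjoin K (Set.range x))
    · by_contra htr
      have a2 := (a1.option_iff_transcendental (Ideal.Quotient.mk p (X i))).2 htr
      apply h2 i hi
      intro g hg hv
      obtain ⟨g', rfl⟩ := exists_rename_eq_of_vars_subset_range g
        (fun o : Option S => o.elim i (fun s : S => (s : σ))) (by
          rintro (_ | a) (_ | b) hab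
          · rfl
          · simp at hab; exact absurd b.2 (hab ▸ hi)
          · simp at hab; exact absurd a.2 (hab ▸ hi)
          · simp at hab; rw [hab]) (by
          intro y hy
          rcases Finset.mem_insert.1 (hv hy) with rfl | hy
          · exact ⟨none, rfl⟩
          · exact ⟨some ⟨y, hy⟩, rfl⟩)
      rw [algebraicIndependent_iff] at a2
      rw [a2 g', map_zero]
      rw [← Ideal.Quotient.eq_zero_iff_mem.2 hg, ← Ideal.Quotient.mkₐ_eq_mk K,
        ← AlgHom.comp_apply]
      congr 1
      ext o : 1
      rcases o with _ | o <;> simp [hx]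
  have hall : ∀ g : MvPolynomial σ K,
      IsAlgebraic (Algebra.adjoin K (Set.range x)) (Ideal.Quotient.mk p g) := by
    intro g
    induction g using MvPolynomial.induction_on with
    | C a =>
      have : (Ideal.Quotient.mk p (C a)) ∈ Algebra.adjoin K (Set.range x) :=
        Subalgebra.algebraMap_mem (Algebra.adjoin K (Set.range x)) a
      exact isAlgebraic_algebraMap (⟨_, this⟩ : Algebra.adjoin K (Set.range x))
    | add a b ha hb => rw [map_add]; exact ha.add hb
    | mul_X a i ha => rw [map_mul]; exact ha.mul (hX i)
  have hJ := Ideal.comap_ne_bot_of_algebraic_mem (R := Algebra.adjoin K (Set.range x))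
    (I := p'.map (Ideal.Quotient.mk p)) (x := Ideal.Quotient.mk p f)
    (by rwa [Ne, Ideal.Quotient.eq_zero_iff_mem]) (Ideal.mem_map_of_mem _ hf) (hall f)
  obtain ⟨a, ha, ha0⟩ := Submodule.exists_mem_ne_zero_of_ne_bot hJ
  obtain ⟨a, ham⟩ := a
  have ham' := ham
  rw [Algebra.adjoin_range_eq_range_aeval] at ham'
  obtain ⟨g, hg⟩ := ham'
  have hg2 : a = Ideal.Quotient.mk p (rename (fun s : S => (s : σ)) g) := by
    have : (aeval x)
        = (Ideal.Quotient.mkₐ K p).comp (rename (fun s : S => (s : σ))) := by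
      ext j : 1
      simp [hx]
    rw [← hg]
    show aeval x g = _
    rw [this]; simp
  have h3 : rename (fun s : S => (s : σ)) g ∈ p' := by
    have h4 : a ∈ p'.map (Ideal.Quotient.mk p) := ha
    rw [hg2] at h4
    have h5 : rename (fun s : S => (s : σ)) g ∈
      (p'.map (Ideal.Quotient.mk p)).comap (Ideal.Quotient.mk p) := h4
    rw [Ideal.comap_map_of_surjective _ Ideal.Quotient.mk_surjective] at h5
    have : Ideal.comap (Ideal.Quotient.mk p) ⊥ = p := by
      rw [← RingHom.ker_eq_comap_bot, Ideal.mk_ker]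
    rw [this, sup_eq_left.2 hle] at h5
    exact h5
  have h6 := h' _ h3 (by
    intro y hy
    have := vars_rename _ _ hy
    simp only [Finset.mem_image] at this
    obtain ⟨y, _, rfl⟩ := this
    exact y.2)
  apply ha0
  apply Subtype.ext
  show a = 0
  rw [hg2, h6, map_zero]

noncomputable def gG (e : σ → ℕ) (u : σ → MvPolynomial σ K) (i : σ) : Polynomial (MvPolynomial σ K) :=
  Polynomial.C (u i) + Polynomial.X * Polynomial.C (X i ^ e i)

noncomputable def gJ (e : σ → ℕ) (u : σ → MvPolynomial σ K) (S : Finset σ) :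
    Ideal (Polynomial (MvPolynomial σ K)) :=
  Ideal.span (gG e u '' ((Sᶜ : Finset σ) : Set σ))

noncomputable def th (S : Finset σ) :
    Polynomial (MvPolynomial S K) →+* Polynomial (MvPolynomial σ K) :=
  Polynomial.mapRingHom (rename (fun s : S => (s : σ))).toRingHom

abbrev Box (e : σ → ℕ) (S : Finset σ) : Type _ := ∀ i : (Sᶜ : Finset σ), Fin (e i)

noncomputable def bmon (e : σ → ℕ) (S : Finset σ) (β : Box e S) :
    Polynomial (MvPolynomial σ K) :=
  Polynomial.C (∏ i : (Sᶜ : Finset σ), X (i : σ) ^ (β i : ℕ))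

def Red (e : σ → ℕ) (u : σ → MvPolynomial σ K) (S : Finset σ) (r : ℕ)
    (F : Polynomial (MvPolynomial σ K)) : Prop :=
  ∃ a : Box e S → Polynomial (MvPolynomial S K),
    Polynomial.X ^ r * F - ∑ β, th S (a β) * bmon e S β ∈ gJ e u S

variable {e : σ → ℕ} {u : σ → MvPolynomial σ K} {S : Finset σ}

lemma th_X : th S (Polynomial.X : Polynomial (MvPolynomial S K)) = Polynomial.X := by
  simp [th]

lemma Red.mono {r r' : ℕ} (hr : r ≤ r') {F} (h : Red e u S r F) : Red e u S r' F := by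
  obtain ⟨a, ha⟩ := h
  obtain ⟨t, rfl⟩ := Nat.exists_eq_add_of_le hr
  refine ⟨fun β => Polynomial.X ^ t * a β, ?_⟩
  have := (gJ e u S).mul_mem_left (Polynomial.X ^ t) ha
  have h2 : ∑ β, th S (Polynomial.X ^ t * a β) * bmon e S β
      = Polynomial.X ^ t * ∑ β, th S (a β) * bmon e S β := by
    rw [Finset.mul_sum]
    refine Finset.sum_congr rfl fun β _ => ?_
    rw [map_mul, map_pow, th_X, mul_assoc]
  rw [h2]
  rw [mul_sub, ← mul_assoc, ← pow_add, add_comm t r] at this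
  exact this

lemma Red.add {r : ℕ} {F F'} (h : Red e u S r F) (h' : Red e u S r F') :
    Red e u S r (F + F') := by
  obtain ⟨a, ha⟩ := h
  obtain ⟨a', ha'⟩ := h'
  refine ⟨fun β => a β + a' β, ?_⟩
  have := (gJ e u S).add_mem ha ha'
  convert this using 1
  simp only [map_add, add_mul, Finset.sum_add_distrib, mul_add]
  ring

lemma red_J {F} (h : F ∈ gJ e u S) (r : ℕ) : Red e u S r F :=
  ⟨fun _ => 0, by simpa using (gJ e u S).mul_mem_left _ h⟩

lemma red_sum {ι : Type*} (s : Finset ι) (F : ι → Polynomial (MvPolynomial σ K))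
    (h : ∀ i ∈ s, ∃ r, Red e u S r (F i)) : ∃ r, Red e u S r (∑ i ∈ s, F i) := by
  classical
  induction s using Finset.induction_on with
  | empty => exact ⟨0, by simpa using red_J (gJ e u S).zero_mem 0⟩
  | insert i s hi ih =>
    obtain ⟨r, hr⟩ := ih fun j hj => h j (Finset.mem_insert_of_mem hj)
    obtain ⟨r', hr'⟩ := h i (Finset.mem_insert_self _ _)
    refine ⟨max r r', ?_⟩
    rw [Finset.sum_insert hi]
    exact (hr'.mono (le_max_right _ _)).add (hr.mono (le_max_left _ _))

lemma red_monomial {w : σ → ℕ} {L : ℕ} (hw : ∀ i, w i * e i = L)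
    (hu : ∀ i ∉ S, ∀ α ∈ (u i).support, ∑ j, w j * α j < L) (n : ℕ) :
    ∀ (α : σ →₀ ℕ) (c : K), ∑ j ∈ Sᶜ, w j * α j = n →
      ∃ r, Red e u S r (Polynomial.C (monomial α c)) := by
  induction n using Nat.strong_induction_on with
  | _ n ih =>
  intro α c hα
  by_cases hb : ∀ i ∉ S, α i < e i
  · refine ⟨0, fun β => if β = (fun i => ⟨α i, hb i (Finset.mem_compl.1 i.2)⟩) then
      Polynomial.C (C c * ∏ s : S, X s ^ α s) else 0, ?_⟩
    rw [Finset.sum_eq_single (fun i => ⟨α i, hb i (Finset.mem_compl.1 i.2)⟩)]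
    · simp only [if_true]
      convert (gJ e u S).zero_mem
      rw [pow_zero, one_mul, sub_eq_zero, th, Polynomial.coe_mapRingHom, Polynomial.map_C, bmon,
        ← Polynomial.C_mul]
      congr 1
      simp only [AlgHom.toRingHom_eq_coe, RingHom.coe_coe, map_mul, map_prod, map_pow, rename_X,
        algHom_C, algebraMap_eq]
      rw [monomial_eq, Finsupp.prod_fintype _ _ (by simp), mul_assoc]
      congr 1
      rw [← Finset.prod_mul_prod_compl S]
      congr 1
      · exact (Finset.prod_coe_sort S (fun i => (X i : MvPolynomial σ K) ^ α i)).symm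
      · exact (Finset.prod_coe_sort Sᶜ (fun i => (X i : MvPolynomial σ K) ^ α i)).symm
    · intro β _ hβ
      simp [hβ]
    · simp
  · push Not at hb
    obtain ⟨i, hi, hie⟩ := hb
    obtain ⟨β, rfl⟩ : ∃ β, α = β + Finsupp.single i (e i) :=
      ⟨α - Finsupp.single i (e i), by
        rw [tsub_add_cancel_of_le]; simpa [Finsupp.single_le_iff] using hie⟩
    have hi' : i ∈ Sᶜ := by simpa using hi
    have hGi : gG e u i ∈ gJ e u S :=
      Ideal.subset_span (by simpa using ⟨i, hi, rfl⟩)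
    have key : Polynomial.X * Polynomial.C (monomial (β + Finsupp.single i (e i)) c)
        = Polynomial.C (monomial β c) * gG e u i
          + ∑ γ ∈ (u i).support, Polynomial.C (monomial (β + γ) ((-c) * coeff γ (u i))) := by
      have h1 : ∑ γ ∈ (u i).support, Polynomial.C (monomial (β + γ) ((-c) * coeff γ (u i)))
          = Polynomial.C (monomial β (-c) * u i) := by
        conv_rhs => rw [(u i).as_sum, Finset.mul_sum, map_sum]
        refine Finset.sum_congr rfl fun γ _ => ?_
        rw [monomial_mul]
      rw [h1, gG, X_pow_eq_monomial, ← mul_one c, ← monomial_mul]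
      simp only [map_mul, mul_one, map_neg]
      ring
    obtain ⟨r, hr⟩ : ∃ r, Red e u S r
        (∑ γ ∈ (u i).support, Polynomial.C (monomial (β + γ) ((-c) * coeff γ (u i)))) := by
      apply red_sum
      intro γ hγ
      refine ih (∑ j ∈ Sᶜ, w j * (β + γ) j) ?_ _ _ rfl
      rw [← hα]
      simp only [Finsupp.add_apply, mul_add, Finset.sum_add_distrib]
      have h1 : ∑ j ∈ Sᶜ, w j * γ j < L :=
        lt_of_le_of_lt (Finset.sum_le_univ_sum_of_nonneg (by simp)) (hu i hi γ hγ)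
      have h2 : ∑ j ∈ Sᶜ, w j * (Finsupp.single i (e i)) j = L := by
        rw [Finset.sum_eq_single i]
        · simp [hw]
        · intro j _ hj; simp [Finsupp.single_apply, hj.symm]
        · intro h; exact absurd hi' h
      omega
    have hr2 : Red e u S r (Polynomial.X * Polynomial.C (monomial (β + Finsupp.single i (e i)) c)) := by
      rw [key]
      exact (red_J ((gJ e u S).mul_mem_left _ hGi) r).add hr
    obtain ⟨a, ha⟩ := hr2
    refine ⟨r + 1, a, ?_⟩
    convert ha using 2
    ring

lemma red_all {w : σ → ℕ} {L : ℕ} (hw : ∀ i, w i * e i = L)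
    (hu : ∀ i ∉ S, ∀ α ∈ (u i).support, ∑ j, w j * α j < L) (f : MvPolynomial σ K) :
    ∃ r, Red e u S r (Polynomial.C f) := by
  rw [f.as_sum, map_sum]
  exact red_sum _ _ fun α _ => red_monomial hw hu _ α _ rfl

end bez

section bez2
variable {σ K : Type*} [Field K] [Fintype σ] [DecidableEq σ]
variable {e : σ → ℕ} {u : σ → MvPolynomial σ K} {S : Finset σ}

def PS (S : Finset σ) (u : σ → MvPolynomial σ K) : Set (Ideal (MvPolynomial σ K)) :=
  {p | p.IsPrime ∧ (∀ i ∉ S, u i ∈ p) ∧ Gen S p}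

def Good (S : Finset σ) (u : σ → MvPolynomial σ K) : Prop :=
  ∀ p ∈ PS S u, ∀ i ∉ S, ¬ Gen (insert i S) p

lemma factorX {ι Λ : Type*} [CommRing Λ] (n : ℕ) : ∀ (c : ι → Polynomial Λ),
    (∃ i, (c i).coeff n ≠ 0) →
    ∃ (s : ℕ) (c' : ι → Polynomial Λ), (∀ i, c i = Polynomial.X ^ s * c' i) ∧
      ∃ i, (c' i).coeff 0 ≠ 0 := by
  induction n with
  | zero => intro c hc; exact ⟨0, c, by simp, hc⟩
  | succ n ih =>
    intro c hc
    by_cases h0 : ∃ i, (c i).coeff 0 ≠ 0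
    · exact ⟨0, c, by simp, h0⟩
    · push Not at h0
      have : ∀ i, ∃ d, c i = Polynomial.X * d := fun i => Polynomial.X_dvd_iff.2 (h0 i)
      choose d hd using this
      obtain ⟨i, hi⟩ := hc
      obtain ⟨s, c', h1, h2⟩ := ih d ⟨i, by rw [hd i, Polynomial.coeff_X_mul] at hi; exact hi⟩
      exact ⟨s + 1, c', fun j => by rw [hd j, h1 j]; ring, h2⟩

lemma mem_topI {p : Ideal (MvPolynomial σ K)} {F} : F ∈ topI p ↔ F.coeff 0 ∈ p := by
  rw [topI, Ideal.mem_comap, Polynomial.coe_evalRingHom, Polynomial.coeff_zero_eq_eval_zero]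

lemma bez_drop (hG : Good S u) {p : Ideal (MvPolynomial σ K)} (hp : p ∈ PS S u) {r : ℕ} {F}
    (h : Polynomial.X ^ r * F ∈ gJ e u S) : F ∈ topI p := by
  have := hp.1
  have hJ : gJ e u S ≤ topI p := by
    rw [gJ, Ideal.span_le]
    rintro _ ⟨i, hi, rfl⟩
    have hi : i ∉ S := by simpa using hi
    show gG e u i ∈ topI p
    rw [mem_topI]
    simpa [gG] using hp.2.1 i hi
  obtain ⟨q, hq, hqp⟩ := Ideal.exists_minimalPrimes_le hJ
  have : q.IsPrime := hq.1.1
  have hXq : Polynomial.X ∉ q := by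
    intro hX
    have hc : (q.comap Polynomial.C) ∈ PS S u := by
      refine ⟨Ideal.comap_isPrime _ _, ?_, ?_⟩
      · intro i hi
        have h1 : gG e u i ∈ q := hq.1.2 (Ideal.subset_span ⟨i, by simpa using hi, rfl⟩)
        rw [Ideal.mem_comap]
        rw [gG] at h1
        exact (q.add_mem_iff_left (q.mul_mem_right _ hX)).1 h1
      · intro f hf hv
        refine hp.2.2 f ?_ hv
        have := hqp hf
        rw [mem_topI] at this
        simpa using this
    have := hc.1
    have heq : q.comap Polynomial.C = p := by
      refine incomp hc.2.2 (hG _ hc) hp.2.2 ?_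
      intro f hf
      have := hqp hf
      rw [mem_topI] at this
      simpa using this
    have hqt : topI p ≤ q := by
      intro G hG'
      rw [mem_topI, ← heq, Ideal.mem_comap] at hG'
      rw [← Polynomial.X_mul_divX_add G]
      exact q.add_mem (q.mul_mem_right _ hX) hG'
    have h1 := Ideal.height_le_card_of_mem_minimalPrimes_span
      ((Finset.finite_toSet Sᶜ).image (gG e u)) hq
    have h2 := topI_height hp.2.2 (hG p hp)
    have h3 : (gG e u '' ((Sᶜ : Finset σ) : Set σ)).ncard ≤ Sᶜ.card := by
      rw [← Set.ncard_coe_finset]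
      exact Set.ncard_image_le (Finset.finite_toSet _)
    have h4 := (h2.trans (Ideal.height_mono hqt)).trans h1
    have h5 : Sᶜ.card + 1 ≤ (gG e u '' ((Sᶜ : Finset σ) : Set σ)).ncard := by exact_mod_cast h4
    omega
  have h1 := hq.1.2 h
  rcases (inferInstance : q.IsPrime).mem_or_mem h1 with h2 | h2
  · exact absurd ((inferInstance : q.IsPrime).mem_of_pow_mem _ h2) hXq
  · exact hqp h2

lemma bez {w : σ → ℕ} {L : ℕ} (hw : ∀ i, w i * e i = L)
    (hu : ∀ i ∉ S, ∀ α ∈ (u i).support, ∑ j, w j * α j < L) (hG : Good S u)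
    (P : Finset (Ideal (MvPolynomial σ K))) (hP : ∀ p ∈ P, p ∈ PS S u) :
    P.card ≤ ∏ i ∈ Sᶜ, e i := by
  classical
  by_contra hlt
  have hbox : Fintype.card (Box e S) = ∏ i ∈ Sᶜ, e i := by
    rw [Fintype.card_pi]
    simp only [Fintype.card_fin]
    exact Finset.prod_coe_sort Sᶜ e
  have hf : ∀ p : P, ∃ f : MvPolynomial σ K, f ∉ p.1 ∧ ∀ p' : P, p' ≠ p → f ∈ p'.1 := by
    intro p
    have := (hP p p.2).1
    have : ∀ p' : P, p' ≠ p → ∃ f ∈ p'.1, f ∉ p.1 := by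
      intro p' hne
      by_contra hcon
      push Not at hcon
      have := (hP p' p'.2).1
      exact hne (Subtype.ext (incomp (hP p' p'.2).2.2 (hG _ (hP p' p'.2)) (hP p p.2).2.2 hcon))
    choose g hg1 hg2 using this
    refine ⟨∏ p' : {p' : P // p' ≠ p}, g p'.1 p'.2, ?_, ?_⟩
    · rw [Ideal.IsPrime.prod_mem_iff]
      rintro ⟨p', _, h⟩
      exact hg2 _ _ h
    · intro p' hne
      exact Ideal.prod_mem _ (Finset.mem_univ (⟨p', hne⟩ : {p' : P // p' ≠ p})) (hg1 p' hne)
  choose f hf1 hf2 using hf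
  have hr : ∃ r, ∀ p : P, Red e u S r (Polynomial.C (f p)) := by
    choose r hr using fun p : P => red_all hw hu (f p)
    exact ⟨Finset.univ.sup r, fun p => (hr p).mono (Finset.le_sup (Finset.mem_univ p))⟩
  obtain ⟨r, hr⟩ := hr
  choose a ha using hr
  have hinj : ¬ Function.Injective (Matrix.mulVecLin
      (Matrix.of fun (β : Box e S) (p : P) => a p β)) := by
    intro h
    have := card_le_of_injective _ _ h
    rw [hbox, Fintype.card_coe] at this
    exact hlt this
  rw [← LinearMap.ker_eq_bot, Submodule.eq_bot_iff] at hinj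
  push Not at hinj
  obtain ⟨c, hc, hc0⟩ := hinj
  have hc1 : ∃ n, ∃ p, (c p).coeff n ≠ 0 := by
    by_contra hcon
    push Not at hcon
    exact hc0 (funext fun p => Polynomial.ext fun n => hcon n p)
  obtain ⟨n, hn⟩ := hc1
  obtain ⟨s, c', h1, p0, h2⟩ := factorX n c hn
  have hc2 : ∀ β, ∑ p : P, a p β * c' p = 0 := by
    intro β
    have h3 : ∑ p : P, a p β * c p = 0 := by
      have := congrFun (LinearMap.mem_ker.1 hc) β
      simpa [Matrix.mulVec, dotProduct] using this
    have h4 : Polynomial.X ^ s * ∑ p : P, a p β * c' p = 0 := by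
      rw [← h3, Finset.mul_sum]
      refine Finset.sum_congr rfl fun p _ => ?_
      rw [h1 p]; ring
    exact (mul_eq_zero.1 h4).resolve_left (pow_ne_zero _ Polynomial.X_ne_zero)
  have hmem : Polynomial.X ^ r * ∑ p : P, th S (c' p) * Polynomial.C (f p) ∈ gJ e u S := by
    have h5 : ∑ p : P, th S (c' p) * (Polynomial.X ^ r * Polynomial.C (f p) -
        ∑ β, th S (a p β) * bmon e S β) ∈ gJ e u S :=
      Ideal.sum_mem _ fun p _ => Ideal.mul_mem_left _ _ (ha p)
    convert h5 using 1
    simp only [mul_sub, Finset.sum_sub_distrib]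
    have h6 : ∑ p : P, th S (c' p) * ∑ β, th S (a p β) * bmon e S β = 0 := by
      simp only [Finset.mul_sum]
      rw [Finset.sum_comm]
      refine Finset.sum_eq_zero fun β _ => ?_
      have : ∑ p : P, th S (c' p) * (th S (a p β) * bmon e S β)
          = th S (∑ p : P, a p β * c' p) * bmon e S β := by
        rw [map_sum, Finset.sum_mul]
        refine Finset.sum_congr rfl fun p _ => ?_
        rw [map_mul]; ring
      rw [this, hc2, map_zero, zero_mul]
    rw [h6, sub_zero, Finset.mul_sum]
    refine Finset.sum_congr rfl fun p _ => ?_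
    ring
  have h7 := bez_drop hG (hP p0 p0.2) hmem
  have := (hP p0 p0.2).1
  rw [mem_topI, Polynomial.finsetSum_coeff, ← Finset.add_sum_erase _ _ (Finset.mem_univ p0)] at h7
  have h8 : ∑ p ∈ Finset.univ.erase p0, (th S (c' p) * Polynomial.C (f p)).coeff 0 ∈ p0.1 := by
    refine Ideal.sum_mem _ fun p hp => ?_
    rw [Polynomial.coeff_mul_C]
    exact Ideal.mul_mem_left _ _ (hf2 p p0 (Finset.ne_of_mem_erase hp).symm)
  have h9 := (p0.1.add_mem_iff_left h8).1 h7
  rw [Polynomial.coeff_mul_C] at h9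
  rcases (inferInstance : p0.1.IsPrime).mem_or_mem h9 with h10 | h10
  · have h11 : (th S (c' p0)).coeff 0 = rename (fun s : S => (s : σ)) ((c' p0).coeff 0) := by
      simp [th]
    rw [h11] at h10
    have h12 := (hP p0 p0.2).2.2 _ h10 (by
      intro y hy
      have := vars_rename _ _ hy
      simp only [Finset.mem_image] at this
      obtain ⟨y, _, rfl⟩ := this
      exact y.2)
    apply h2
    exact rename_injective _ Subtype.val_injective (by rw [h12, map_zero])
  · exact hf1 p0 h10

end bez2

section cnt
variable {σ K V : Type*} [Field K] [Fintype K] [Fintype σ] [DecidableEq σ]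

lemma fiber_bound [Fintype V] [Nonempty V] (W : (σ → V) → Prop) (i : σ) (M c : ℕ)
    (h : ∀ v, Nat.card {x // W (Function.update v i x)} * c ≤ M * Fintype.card V) :
    Nat.card {v // W v} * c ≤ M * Fintype.card V ^ Fintype.card σ := by
  classical
  have e1 : {z : (σ → V) × V // W (Function.update z.1 i z.2)} ≃ {z : (σ → V) × V // W z.1} :=
    { toFun := fun z => ⟨(Function.update z.1.1 i z.1.2, z.1.1 i), z.2⟩
      invFun := fun z => ⟨(Function.update z.1.1 i z.1.2, z.1.1 i), by
        have := z.2
        simpa using this⟩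
      left_inv := by rintro ⟨⟨v, x⟩, h⟩; simp
      right_inv := by rintro ⟨⟨v, x⟩, h⟩; simp }
  have e2 : {z : (σ → V) × V // W z.1} ≃ {v // W v} × V :=
    { toFun := fun z => (⟨z.1.1, z.2⟩, z.1.2)
      invFun := fun z => ⟨(z.1.1, z.2), z.1.2⟩
      left_inv := fun _ => rfl
      right_inv := fun _ => rfl }
  have e3 : {z : (σ → V) × V // W (Function.update z.1 i z.2)}
      ≃ Σ v : σ → V, {x // W (Function.update v i x)} :=
    { toFun := fun z => ⟨z.1.1, z.1.2, z.2⟩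
      invFun := fun z => ⟨(z.1, z.2.1), z.2.2⟩
      left_inv := fun _ => rfl
      right_inv := fun _ => rfl }
  have h1 : Nat.card {v // W v} * Fintype.card V
      = ∑ v : σ → V, Nat.card {x // W (Function.update v i x)} := by
    rw [← Nat.card_eq_fintype_card, ← Nat.card_prod, ← Nat.card_congr e2, ← Nat.card_congr e1,
      Nat.card_congr e3, Nat.card_sigma]
  have h2 : (Nat.card {v // W v} * c) * Fintype.card V
      ≤ (M * Fintype.card V ^ Fintype.card σ) * Fintype.card V := by
    rw [mul_right_comm, h1, Finset.sum_mul]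
    calc _ ≤ ∑ v : σ → V, M * Fintype.card V := Finset.sum_le_sum fun v _ => h v
      _ = _ := by rw [Finset.sum_const, Finset.card_univ, Fintype.card_fun]; simp; ring
  exact Nat.le_of_mul_le_mul_right h2 Fintype.card_pos

variable [AddCommGroup V] [Fintype V] (ψ : V →+ MvPolynomial σ K) {d : ℕ}

lemma cnt_prime (hpow : ∀ (i : σ) (g : Fin d → K), ∃ v, ψ v = ∑ j, C (g j) * X i ^ (j : ℕ))
    {T : Finset σ} {i : σ} (hi : i ∈ T) {p : Ideal (MvPolynomial σ K)} (hp : Gen T p) :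
    Nat.card {v // ψ v ∈ p} * Fintype.card K ^ d ≤ Fintype.card V := by
  choose ι hι using hpow i
  have hinj : Function.Injective (fun z : {v // ψ v ∈ p} × (Fin d → K) => z.1.1 + ι z.2) := by
    rintro ⟨⟨v, hv⟩, g⟩ ⟨⟨v', hv'⟩, g'⟩ h
    simp only at h
    have h1 : ψ (ι g) - ψ (ι g') ∈ p := by
      have h2 : ψ v + ψ (ι g) = ψ v' + ψ (ι g') := by rw [← map_add, ← map_add, h]
      have h3 : ψ (ι g) - ψ (ι g') = ψ v' - ψ v := by linear_combination h2
      rw [h3]; exact p.sub_mem hv' hv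
    have h4 : ψ (ι g) - ψ (ι g') = ∑ j, C (g j - g' j) * X i ^ (j : ℕ) := by
      rw [hι, hι, ← Finset.sum_sub_distrib]
      refine Finset.sum_congr rfl fun j _ => ?_
      rw [C_sub]; ring
    rw [h4] at h1
    have h5 := hp _ h1 (by
      refine (vars_sum_subset _ _).trans ?_
      intro y hy
      rw [Finset.mem_biUnion] at hy
      obtain ⟨j, _, hy⟩ := hy
      have := (vars_mul _ _) hy
      rw [vars_C, Finset.empty_union] at this
      have := (vars_pow _ _) this
      rw [vars_X, Finset.mem_singleton] at this
      rw [this]; exact hi)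
    have hg : g = g' := by
      funext j
      have h6 := congrArg (coeff (Finsupp.single i (j : ℕ))) h5
      rw [coeff_sum, Finset.sum_eq_single j] at h6
      · rw [coeff_C_mul, X_pow_eq_monomial, coeff_monomial, if_pos rfl, mul_one, coeff_zero,
          sub_eq_zero] at h6
        exact h6
      · intro b _ hb
        rw [coeff_C_mul, X_pow_eq_monomial, coeff_monomial, if_neg, mul_zero]
        intro h7
        exact hb (Fin.ext (Finsupp.single_injective i h7))
      · simp
    subst hg
    simp at h
    simp [h]
  have := Nat.card_le_card_of_injective _ hinj
  rw [Nat.card_prod, Nat.card_eq_fintype_card (α := Fin d → K), Nat.card_eq_fintype_card (α := V)] at this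
  simpa using this

def cc (E : ℕ) : ℕ → ℕ
  | 0 => 0
  | m + 1 => (m + 1) * (cc E m + E)

lemma PS_congr {S : Finset σ} {u u' : σ → MvPolynomial σ K} (h : ∀ i ∉ S, u i = u' i) :
    PS S u = PS S u' := by
  ext p
  simp only [PS, Set.mem_ofPred_eq]
  refine and_congr_right fun _ => and_congr_left fun _ => ?_
  exact forall_congr' fun i => forall_congr' fun hi => by rw [h i hi]

lemma Good_congr {S : Finset σ} {u u' : σ → MvPolynomial σ K} (h : ∀ i ∉ S, u i = u' i) :
    Good S u ↔ Good S u' := by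
  unfold Good; rw [PS_congr h]

lemma card_exists_le {α β : Type*} [Finite α] (P : Finset β) (Q : β → α → Prop) :
    Nat.card {a // ∃ b ∈ P, Q b a} ≤ ∑ b ∈ P, Nat.card {a // Q b a} := by
  classical
  have := Fintype.ofFinite α
  simp only [Nat.card_eq_fintype_card, Fintype.card_subtype]
  refine le_trans (Finset.card_le_card ?_) Finset.card_biUnion_le
  intro a
  simp

lemma card_or_le {α : Type*} [Finite α] (P Q : α → Prop) :
    Nat.card {a // P a ∨ Q a} ≤ Nat.card {a // P a} + Nat.card {a // Q a} := by
  classical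
  have := Fintype.ofFinite α
  simp only [Nat.card_eq_fintype_card]
  exact Fintype.card_subtype_or P Q

lemma card_mono' {α : Type*} [Finite α] {P Q : α → Prop} (h : ∀ a, P a → Q a) :
    Nat.card {a // P a} ≤ Nat.card {a // Q a} :=
  Nat.card_le_card_of_injective (Subtype.map id h) (Subtype.map_injective h Function.injective_id)

lemma step_bound {e w : σ → ℕ} {L E : ℕ} (hw : ∀ i, w i * e i = L)
    (hE : ∀ S : Finset σ, ∏ i ∈ S, e i ≤ E)
    (hdeg : ∀ v, ∀ α ∈ (ψ v).support, ∑ j, w j * α j < L)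
    (hpow : ∀ (i : σ) (g : Fin d → K), ∃ v, ψ v = ∑ j, C (g j) * X i ^ (j : ℕ))
    (S : Finset σ) (i : σ) :
    Nat.card {v : σ → V // Good (insert i S) (fun j => ψ (v j)) ∧
      ∃ p ∈ PS (insert i S) (fun j => ψ (v j)), ψ (v i) ∈ p} * Fintype.card K ^ d
      ≤ E * Fintype.card V ^ Fintype.card σ := by
  apply fiber_bound (V := V) (fun v => Good (insert i S) (fun j => ψ (v j)) ∧
      ∃ p ∈ PS (insert i S) (fun j => ψ (v j)), ψ (v i) ∈ p) i
  intro v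
  have hc : ∀ x, ∀ j ∉ insert i S, ψ (Function.update v i x j) = ψ (v j) := by
    intro x j hj
    rw [Function.update_of_ne]
    rintro rfl
    simp at hj
  have h1 : ∀ x, (Good (insert i S) (fun j => ψ (Function.update v i x j)) ∧
      ∃ p ∈ PS (insert i S) (fun j => ψ (Function.update v i x j)),
        ψ (Function.update v i x i) ∈ p) ↔ (Good (insert i S) (fun j => ψ (v j)) ∧
      ∃ p ∈ PS (insert i S) (fun j => ψ (v j)), ψ x ∈ p) := by
    intro x
    rw [PS_congr (hc x), Good_congr (hc x), Function.update_self]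
  simp only [h1]
  by_cases hG : Good (insert i S) (fun j => ψ (v j))
  swap
  · simp [hG]
  have hfin : (PS (insert i S) (fun j => ψ (v j))).Finite := by
    by_contra hinf
    obtain ⟨P, hP, hPc⟩ := (show Set.Infinite _ from hinf).exists_subset_card_eq (E + 1)
    have := (bez hw (fun i _ => hdeg (v i)) hG P fun p hp => hP hp).trans (hE _)
    omega
  have hcard := (bez hw (fun i _ => hdeg (v i)) hG hfin.toFinset
    fun p hp => hfin.mem_toFinset.1 hp).trans (hE _)
  calc _ ≤ Nat.card {x // ∃ p ∈ hfin.toFinset, ψ x ∈ p} * Fintype.card K ^ d := by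
        gcongr
        apply card_mono'
        rintro x ⟨_, p, hp, hx⟩
        exact ⟨p, hfin.mem_toFinset.2 hp, hx⟩
    _ ≤ (∑ p ∈ hfin.toFinset, Nat.card {x // ψ x ∈ p}) * Fintype.card K ^ d := by
        gcongr
        exact card_exists_le _ _
    _ ≤ ∑ p ∈ hfin.toFinset, Fintype.card V := by
        rw [Finset.sum_mul]
        refine Finset.sum_le_sum fun p hp => ?_
        exact cnt_prime ψ hpow (Finset.mem_insert_self i S) (hfin.mem_toFinset.1 hp).2.2
    _ ≤ E * Fintype.card V := by
        rw [Finset.sum_const, smul_eq_mul]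
        gcongr

lemma bad_bound {e w : σ → ℕ} {L E : ℕ} (hw : ∀ i, w i * e i = L)
    (hE : ∀ S : Finset σ, ∏ i ∈ S, e i ≤ E)
    (hdeg : ∀ v, ∀ α ∈ (ψ v).support, ∑ j, w j * α j < L)
    (hpow : ∀ (i : σ) (g : Fin d → K), ∃ v, ψ v = ∑ j, C (g j) * X i ^ (j : ℕ)) (m : ℕ) :
    ∀ S : Finset σ, Sᶜ.card = m →
    Nat.card {v : σ → V // ¬ Good S (fun j => ψ (v j))} * Fintype.card K ^ d
      ≤ cc E m * Fintype.card V ^ Fintype.card σ := by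
  induction m with
  | zero =>
    intro S hS
    have hS : ∀ i, i ∈ S := by
      rw [Finset.card_eq_zero, Finset.compl_eq_empty_iff] at hS
      simp [hS]
    have : ∀ v : σ → V, Good S (fun j => ψ (v j)) := fun v p _ i hi => absurd (hS i) hi
    simp [this]
  | succ m ih =>
    intro S hS
    calc _ ≤ Nat.card {v : σ → V // ∃ i ∈ Sᶜ, (¬ Good (insert i S) (fun j => ψ (v j)) ∨
          (Good (insert i S) (fun j => ψ (v j)) ∧
            ∃ p ∈ PS (insert i S) (fun j => ψ (v j)), ψ (v i) ∈ p))} * Fintype.card K ^ d := by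
          gcongr
          apply card_mono'
          intro v hv
          simp only [Good, not_forall, not_not] at hv
          obtain ⟨p, hp, i, hi, hg⟩ := hv
          refine ⟨i, by simpa using hi, ?_⟩
          by_cases hG : Good (insert i S) (fun j => ψ (v j))
          · right
            refine ⟨hG, p, ⟨hp.1, fun j hj => hp.2.1 j ?_, hg⟩, hp.2.1 i hi⟩
            intro h; exact hj (Finset.mem_insert_of_mem h)
          · exact Or.inl hG
      _ ≤ (∑ i ∈ Sᶜ, (Nat.card {v : σ → V // ¬ Good (insert i S) (fun j => ψ (v j))} +
          Nat.card {v : σ → V // (Good (insert i S) (fun j => ψ (v j)) ∧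
            ∃ p ∈ PS (insert i S) (fun j => ψ (v j)), ψ (v i) ∈ p)})) * Fintype.card K ^ d := by
          gcongr
          refine (card_exists_le _ _).trans (Finset.sum_le_sum fun i _ => ?_)
          exact card_or_le _ _
      _ ≤ ∑ i ∈ Sᶜ, (cc E m * Fintype.card V ^ Fintype.card σ +
            E * Fintype.card V ^ Fintype.card σ) := by
          rw [Finset.sum_mul]
          refine Finset.sum_le_sum fun i hi => ?_
          rw [add_mul]
          refine add_le_add (ih _ ?_) (step_bound ψ hw hE hdeg hpow S i)
          rw [Finset.compl_insert, Finset.card_erase_of_mem hi, hS]; rfl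
      _ = _ := by
          rw [Finset.sum_const, hS, cc, smul_eq_mul]; ring

lemma good_zeros {e w : σ → ℕ} {L E : ℕ} (hw : ∀ i, w i * e i = L)
    (hE : ∀ S : Finset σ, ∏ i ∈ S, e i ≤ E) (u : σ → MvPolynomial σ K)
    (hdeg : ∀ i, ∀ α ∈ (u i).support, ∑ j, w j * α j < L) (hG : Good ∅ u) :
    Nat.card {x : σ → K // ∀ i, eval x (u i) = 0} ≤ E := by
  classical
  let Φ : (σ → K) → Ideal (MvPolynomial σ K) := fun x => RingHom.ker (eval x)
  have hΦ : Function.Injective Φ := by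
    intro x y hxy
    funext i
    have h1 : X i - C (x i) ∈ Φ x := by simp [Φ, RingHom.mem_ker]
    rw [hxy] at h1
    simp [Φ, RingHom.mem_ker, sub_eq_zero] at h1
    exact h1.symm
  let Z := Finset.univ.filter fun x : σ → K => ∀ i, eval x (u i) = 0
  have h2 := (bez hw (fun i _ => hdeg i) hG (Z.image Φ) (by
    intro p hp
    obtain ⟨x, hx, rfl⟩ := Finset.mem_image.1 hp
    have hx : ∀ i, eval x (u i) = 0 := by simpa [Z] using hx
    refine ⟨RingHom.ker_isPrime _, fun i _ => hx i, ?_⟩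
    intro f hf hv
    have hf' : eval x f = 0 := hf
    rw [Finset.subset_empty, vars_eq_empty_iff_eq_C] at hv
    rw [hv, eval_C] at hf'
    rw [hv, hf', C_0])).trans (hE _)
  rw [Finset.card_image_of_injective _ hΦ] at h2
  rwa [Nat.card_eq_fintype_card, Fintype.card_subtype]

end cnt

section moment
variable {K Ω Ξ : Type*} [Field K] [Fintype K]

lemma count_rep (m : ℕ) (hm : 0 < m) (F : Finset (Fin (2 * m) → K))
    (hF : ∀ f ∈ F, ¬ ∃ j0, ∀ j, j ≠ j0 → f j ≠ f j0) :
    F.card ≤ Fintype.card K ^ m * m ^ (2 * m) := by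
  classical
  have h1 : F ⊆ (Finset.univ : Finset ((Fin m → K) × (Fin (2 * m) → Fin m))).image
      (fun z => z.1 ∘ z.2) := by
    intro f hf
    have hf' := hF f hf
    push Not at hf'
    have h2 : (Finset.univ.image f).card ≤ m := by
      have h3 := Finset.card_eq_sum_card_image f Finset.univ
      have h4 : ∑ b ∈ Finset.univ.image f, 2
          ≤ ∑ b ∈ Finset.univ.image f, (Finset.univ.filter fun a => f a = b).card := by
        refine Finset.sum_le_sum fun b hb => ?_
        obtain ⟨j0, _, rfl⟩ := Finset.mem_image.1 hb
        obtain ⟨j, hj, hjj⟩ := hf' j0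
        have : ({j, j0} : Finset _) ⊆ Finset.univ.filter fun a => f a = f j0 := by
          intro y hy
          rcases Finset.mem_insert.1 hy with rfl | hy
          · simp [hjj]
          · rw [Finset.mem_singleton] at hy; simp [hy]
        calc 2 = ({j, j0} : Finset _).card := (Finset.card_pair hj).symm
          _ ≤ _ := Finset.card_le_card this
      rw [← h3] at h4
      simp at h4
      omega
    obtain ⟨φ⟩ : Nonempty ((Finset.univ.image f : Finset K) ↪ Fin m) :=
      Function.Embedding.nonempty_of_card_le (by rwa [Fintype.card_coe, Fintype.card_fin])
    have : Nonempty (Finset.univ.image f : Finset K) :=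
      ⟨⟨f ⟨0, by omega⟩, Finset.mem_image_of_mem _ (Finset.mem_univ _)⟩⟩
    refine Finset.mem_image.2 ⟨(fun l => (Function.invFun φ l).1,
      fun j => φ ⟨f j, Finset.mem_image_of_mem _ (Finset.mem_univ _)⟩), Finset.mem_univ _, ?_⟩
    funext j
    simp only [Function.comp]
    rw [Function.leftInverse_invFun φ.injective]
  calc F.card ≤ _ := Finset.card_le_card h1
    _ ≤ _ := Finset.card_image_le
    _ = _ := by simp

lemma moment [Fintype Ω] (m : ℕ) (hm : 0 < m) (Y : K → Ω → ℝ) (hY : ∀ t ω, |Y t ω| ≤ 2)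
    (hv : ∀ f : Fin (2 * m) → K, (∃ j0, ∀ j, j ≠ j0 → f j ≠ f j0) →
      ∑ ω, ∏ j, Y (f j) ω = 0) :
    ∑ ω, (∑ t, Y t ω) ^ (2 * m)
      ≤ Fintype.card Ω * 2 ^ (2 * m) * (Fintype.card K ^ m * m ^ (2 * m)) := by
  classical
  simp only [Fintype.sum_pow]
  rw [Finset.sum_comm]
  let F := Finset.univ.filter fun f : Fin (2 * m) → K => ¬ ∃ j0, ∀ j, j ≠ j0 → f j ≠ f j0
  have h1 : ∑ f : Fin (2 * m) → K, ∑ ω, ∏ j, Y (f j) ω = ∑ f ∈ F, ∑ ω, ∏ j, Y (f j) ω := by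
    symm
    apply Finset.sum_subset (Finset.subset_univ _)
    intro f _ hf
    apply hv
    by_contra hcon
    exact hf (Finset.mem_filter.2 ⟨Finset.mem_univ _, hcon⟩)
  rw [h1]
  have h2 : ∀ f ∈ F, ∑ ω, ∏ j, Y (f j) ω ≤ Fintype.card Ω * 2 ^ (2 * m) := by
    intro f _
    calc ∑ ω, ∏ j, Y (f j) ω ≤ ∑ ω : Ω, (2 : ℝ) ^ (2 * m) := by
          refine Finset.sum_le_sum fun ω _ => ?_
          refine (le_abs_self _).trans ?_
          rw [Finset.abs_prod]
          calc ∏ j, |Y (f j) ω| ≤ ∏ j : Fin (2 * m), (2 : ℝ) :=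
                Finset.prod_le_prod (fun _ _ => abs_nonneg _) fun _ _ => hY _ _
            _ = _ := by simp
      _ = _ := by simp
  refine (Finset.sum_le_sum h2).trans ?_
  rw [Finset.sum_const, nsmul_eq_mul, mul_comm]
  have h3 := count_rep m hm F (fun f hf => (Finset.mem_filter.1 hf).2)
  have h4 : (F.card : ℝ) ≤ (Fintype.card K ^ m * m ^ (2 * m) : ℝ) := by exact_mod_cast h3
  gcongr

lemma dev_bound [AddCommGroup Ω] [Fintype Ω] [AddCommGroup Ξ] [Module K Ξ] [Fintype Ξ]
    (m : ℕ) (hm : 0 < m) (X : K → Ω → ℝ) (hX0 : ∀ t ω, 0 ≤ X t ω) (hX2 : ∀ t ω, X t ω ≤ 2)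
    (T : (Fin (2 * m) → K) → Ξ → Ω) (T0 : Ξ →+ Ω)
    (hT : ∀ c s t ω, X t (ω + T c s) = X t (ω + T0 ((∑ j, c j * t ^ (j : ℕ)) • s)))
    (hmean : ∀ t ω, (5 / 6 : ℝ) * Fintype.card Ξ ≤ ∑ s, X t (ω + T0 s)) :
    (Nat.card {ω // ∑ t, X t ω < (Fintype.card K : ℝ) / 2} : ℝ) * Fintype.card K ^ m
      ≤ Fintype.card Ω * (6 * m) ^ (2 * m) := by
  classical
  set q : ℝ := (Fintype.card K : ℝ) with hq
  have hqpos : 0 < q := by rw [hq]; exact_mod_cast Fintype.card_pos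
  set ξ : ℝ := (Fintype.card Ξ : ℝ) with hξ
  have hξpos : 0 < ξ := by rw [hξ]; exact_mod_cast Fintype.card_pos
  let μ : K → Ω → ℝ := fun t ω => (∑ s, X t (ω + T0 s)) / ξ
  have hμ0 : ∀ t ω, 0 ≤ μ t ω := fun t ω =>
    div_nonneg (Finset.sum_nonneg fun s _ => hX0 _ _) hξpos.le
  have hμ2 : ∀ t ω, μ t ω ≤ 2 := fun t ω => by
    rw [div_le_iff₀ hξpos]
    calc ∑ s, X t (ω + T0 s) ≤ ∑ s : Ξ, (2 : ℝ) := Finset.sum_le_sum fun s _ => hX2 _ _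
      _ = _ := by simp [hξ, mul_comm]
  have hμ5 : ∀ t ω, 5 / 6 ≤ μ t ω := fun t ω => by
    rw [le_div_iff₀ hξpos]; exact hmean t ω
  have hμT0 : ∀ t ω s, μ t (ω + T0 s) = μ t ω := by
    intro t ω s
    simp only [μ]
    congr 1
    rw [← Equiv.sum_comp (Equiv.addLeft s) (fun s' => X t (ω + T0 s'))]
    refine Finset.sum_congr rfl fun s' _ => ?_
    simp [add_assoc]
  have hμT : ∀ c s t ω, μ t (ω + T c s) = μ t (ω + T0 ((∑ j, c j * t ^ (j : ℕ)) • s)) := by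
    intro c s t ω
    simp only [μ]
    congr 1
    refine Finset.sum_congr rfl fun s' _ => ?_
    rw [add_right_comm, hT, add_right_comm]
  let Y : K → Ω → ℝ := fun t ω => X t ω - μ t ω
  have hY : ∀ t ω, |Y t ω| ≤ 2 := fun t ω => by
    rw [abs_le]
    constructor
    · have := hX0 t ω; have := hμ2 t ω; simp only [Y]; linarith
    · have := hX2 t ω; have := hμ0 t ω; simp only [Y]; linarith
  have hv : ∀ f : Fin (2 * m) → K, (∃ j0, ∀ j, j ≠ j0 → f j ≠ f j0) →
      ∑ ω, ∏ j, Y (f j) ω = 0 := by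
    rintro f ⟨j0, hj0⟩
    let P : Polynomial K := ∏ j ∈ Finset.univ.erase j0, (Polynomial.X - Polynomial.C (f j))
    have hPd : P.natDegree < 2 * m := by
      rw [Polynomial.natDegree_prod_of_monic _ _ fun j _ => Polynomial.monic_X_sub_C _]
      simp
      omega
    have hP0 : ∀ j, j ≠ j0 → P.eval (f j) = 0 := by
      intro j hj
      rw [Polynomial.eval_prod]
      exact Finset.prod_eq_zero (Finset.mem_erase.2 ⟨hj, Finset.mem_univ _⟩) (by simp)
    have hP1 : P.eval (f j0) ≠ 0 := by
      rw [Polynomial.eval_prod, Finset.prod_ne_zero_iff]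
      intro j hj
      simp only [Polynomial.eval_sub, Polynomial.eval_X, Polynomial.eval_C]
      exact sub_ne_zero.2 (hj0 j (Finset.ne_of_mem_erase hj)).symm
    let c : Fin (2 * m) → K := fun j => P.coeff j / P.eval (f j0)
    have hc : ∀ t, ∑ j, c j * t ^ (j : ℕ) = P.eval t / P.eval (f j0) := by
      intro t
      rw [Polynomial.eval_eq_sum_range' hPd, Finset.sum_div,
        ← Fin.sum_univ_eq_sum_range (fun i => P.coeff i * t ^ i / Polynomial.eval (f j0) P)]
      refine Finset.sum_congr rfl fun j _ => ?_
      simp only [c]; ring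
    have hYo : ∀ j, j ≠ j0 → ∀ ω s, Y (f j) (ω + T c s) = Y (f j) ω := by
      intro j hj ω s
      simp only [Y]
      rw [hT, hμT, hc, hP0 j hj]
      simp
    have hYs : ∀ ω, ∑ s, Y (f j0) (ω + T c s) = 0 := by
      intro ω
      have : ∀ s, Y (f j0) (ω + T c s) = X (f j0) (ω + T0 s) - μ (f j0) ω := by
        intro s
        simp only [Y]
        rw [hT, hμT, hc, div_self hP1, one_smul, hμT0]
      simp only [this, Finset.sum_sub_distrib]
      simp only [μ, Finset.sum_const, Finset.card_univ, nsmul_eq_mul]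
      rw [← hξ]
      field_simp
      ring
    have h1 : ∀ s, ∑ ω, ∏ j, Y (f j) ω = ∑ ω, ∏ j, Y (f j) (ω + T c s) := fun s =>
      (Equiv.sum_comp (Equiv.addRight (T c s)) (fun ω => ∏ j, Y (f j) ω)).symm
    have h2 : ξ * ∑ ω, ∏ j, Y (f j) ω = 0 := by
      calc ξ * ∑ ω, ∏ j, Y (f j) ω = ∑ s : Ξ, ∑ ω, ∏ j, Y (f j) ω := by simp [hξ]
        _ = ∑ s : Ξ, ∑ ω, ∏ j, Y (f j) (ω + T c s) := Finset.sum_congr rfl fun s _ => h1 s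
        _ = ∑ ω, ∑ s : Ξ, ∏ j, Y (f j) (ω + T c s) := Finset.sum_comm
        _ = 0 := by
          refine Finset.sum_eq_zero fun ω _ => ?_
          have : ∀ s, ∏ j, Y (f j) (ω + T c s)
              = Y (f j0) (ω + T c s) * ∏ j ∈ Finset.univ.erase j0, Y (f j) ω := by
            intro s
            rw [← Finset.mul_prod_erase _ _ (Finset.mem_univ j0)]
            congr 1
            exact Finset.prod_congr rfl fun j hj => hYo j (Finset.ne_of_mem_erase hj) ω s
          simp only [this]
          rw [← Finset.sum_mul, hYs, zero_mul]
    exact (mul_eq_zero.1 h2).resolve_left hξpos.ne'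
  have hmom := moment m hm Y hY hv
  let B := Finset.univ.filter fun ω => ∑ t, X t ω < q / 2
  have hB : (B.card : ℝ) * (q / 3) ^ (2 * m) ≤ ∑ ω, (∑ t, Y t ω) ^ (2 * m) := by
    calc (B.card : ℝ) * (q / 3) ^ (2 * m) = ∑ ω ∈ B, (q / 3) ^ (2 * m) := by simp
      _ ≤ ∑ ω ∈ B, (∑ t, Y t ω) ^ (2 * m) := by
        refine Finset.sum_le_sum fun ω hω => ?_
        have h1 : ∑ t, X t ω < q / 2 := (Finset.mem_filter.1 hω).2
        have h2 : ∑ t : K, (5 / 6 : ℝ) ≤ ∑ t, μ t ω := Finset.sum_le_sum fun t _ => hμ5 t ω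
        have h3 : ∑ t : K, (5 / 6 : ℝ) = q * (5 / 6) := by simp [hq]
        have h4 : ∑ t, Y t ω = ∑ t, X t ω - ∑ t, μ t ω := Finset.sum_sub_distrib _ _
        rw [← Even.neg_pow (even_two_mul m) (∑ t, Y t ω)]
        apply pow_le_pow_left₀ (by positivity)
        rw [h4]; linarith
      _ ≤ _ := Finset.sum_le_sum_of_subset_of_nonneg (Finset.subset_univ _)
        fun ω _ _ => Even.pow_nonneg (even_two_mul m) _
  have hcard : (Nat.card {ω // ∑ t, X t ω < q / 2} : ℝ) = B.card := by
    rw [Nat.card_eq_fintype_card, Fintype.card_subtype]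
  rw [hcard]
  have h5 := hB.trans hmom
  rw [← hq] at h5
  have h6 : (B.card : ℝ) * (q / 3) ^ (2 * m) = (B.card * q ^ m) * (q ^ m / 3 ^ (2 * m)) := by
    rw [div_pow, two_mul m, pow_add q]; ring
  rw [h6] at h5
  have h7 : (Fintype.card Ω : ℝ) * 2 ^ (2 * m) * (q ^ m * m ^ (2 * m))
      = (Fintype.card Ω * (6 * m) ^ (2 * m)) * (q ^ m / 3 ^ (2 * m)) := by
    rw [show (6 * m : ℝ) = 3 * 2 * m by norm_num, mul_pow, mul_pow]
    field_simp
  rw [h7] at h5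
  exact le_of_mul_le_mul_right h5 (by positivity)

end moment

section mean
variable {σ K : Type*} [Field K] [Fintype K] [Fintype σ] [DecidableEq σ]

def hv (o : σ) (x : σ → K) (i : σ) : K := if i = o then 1 else x i

def AA (o : σ) (x s : σ → K) : K := ∑ l, s l * hv o x l

lemma AA_add (o : σ) (x s s' : σ → K) : AA o x (s + s') = AA o x s + AA o x s' := by
  simp [AA, add_mul, Finset.sum_add_distrib]

lemma AA_single (o : σ) (x : σ → K) (l : σ) (c : K) : AA o x (Pi.single l c) = c * hv o x l := by
  rw [AA, Finset.sum_eq_single l]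
  · simp
  · intro b _ hb; simp [hb]
  · simp

lemma hv_o (o : σ) (x : σ → K) : hv o x o = 1 := by simp [hv]

lemma cnt_one (o : σ) (x : σ → K) (a : σ → K) :
    Fintype.card (σ → σ → K) ≤ Nat.card {s : σ → σ → K // ∀ i, AA o x (s i) = a i}
      * Fintype.card K ^ Fintype.card σ := by
  have hs : Function.Surjective
      (fun z : {s : σ → σ → K // ∀ i, AA o x (s i) = a i} × (σ → K) =>
        (fun i => z.1.1 i + Pi.single o (z.2 i) : σ → σ → K)) := by
    intro z
    refine ⟨(⟨fun i => z i + Pi.single o (a i - AA o x (z i)), ?_⟩,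
      fun i => - (a i - AA o x (z i))), ?_⟩
    · intro i
      rw [AA_add, AA_single, hv_o]; ring
    · funext i
      simp only
      rw [add_assoc, ← Pi.single_add]; simp
  have := Nat.card_le_card_of_surjective _ hs
  rw [Nat.card_prod] at this
  simpa [Nat.card_eq_fintype_card] using this

lemma cnt_two (o : σ) (x x' : σ → K) (hx : x o = x' o) (hne : x ≠ x') (a a' : σ → K) :
    Nat.card {s : σ → σ → K // (∀ i, AA o x (s i) = a i) ∧ (∀ i, AA o x' (s i) = a' i)}
      * (Fintype.card K ^ Fintype.card σ * Fintype.card K ^ Fintype.card σ)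
      ≤ Fintype.card (σ → σ → K) := by
  obtain ⟨l, hl⟩ := Function.ne_iff.1 hne
  have hlo : l ≠ o := by rintro rfl; exact hl hx
  have hs : Function.Injective
      (fun z : {s : σ → σ → K // (∀ i, AA o x (s i) = a i) ∧ (∀ i, AA o x' (s i) = a' i)}
          × ((σ → K) × (σ → K)) =>
        (fun i => z.1.1 i + Pi.single o (z.2.1 i) + Pi.single l (z.2.2 i) : σ → σ → K)) := by
    rintro ⟨⟨s, h1, h2⟩, c, c'⟩ ⟨⟨r, g1, g2⟩, b, b'⟩ h
    simp only at h
    have key : ∀ i, c i = b i ∧ c' i = b' i := by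
      intro i
      have e1 := congrArg (AA o x) (congrFun h i)
      have e2 := congrArg (AA o x') (congrFun h i)
      simp only [AA_add, AA_single, hv_o, h1, h2, g1, g2] at e1 e2
      simp only [hv, if_neg hlo] at e1 e2
      have e3 : (c' i - b' i) * (x l - x' l) = 0 := by linear_combination e1 - e2
      have e4 : c' i = b' i :=
        sub_eq_zero.1 ((mul_eq_zero.1 e3).resolve_right (sub_ne_zero.2 hl))
      refine ⟨?_, e4⟩
      rw [e4] at e1
      linear_combination e1
    have hc : c = b := funext fun i => (key i).1
    have hc' : c' = b' := funext fun i => (key i).2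
    subst hc; subst hc'
    have : s = r := by
      funext i
      have := congrFun h i
      simpa using this
    subst this
    rfl
  have := Nat.card_le_card_of_injective _ hs
  rw [Nat.card_prod, Nat.card_prod] at this
  simpa [Nat.card_eq_fintype_card] using this

lemma min_ineq (N : ℕ) : 6 * N ≤ 6 * min N 2 + (N * N - N) := by
  by_cases h : N ≤ 6
  · interval_cases N <;> simp
  · push Not at h
    have : 7 * N ≤ N * N := Nat.mul_le_mul_right N h
    have : min N 2 = 2 := by omega
    omega

lemma mean_bound (o : σ) (t : K) (φ : σ → (σ → K) → K) :
    5 * Fintype.card (σ → σ → K) ≤ 6 * ∑ s : σ → σ → K,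
      min (Nat.card {z : (σ → K) × K // z.1 o = t ∧ ∀ i, φ i z.1 + AA o z.1 (s i) = z.2}) 2 := by
  classical
  set q := Fintype.card K with hq
  set k := Fintype.card σ with hk
  have hqpos : 0 < q ^ k := pow_pos Fintype.card_pos _
  let Z : Finset ((σ → K) × K) := Finset.univ.filter fun z => z.1 o = t
  have hZ : Z.card = q ^ k := by
    have : Z.card = (Finset.univ : Finset (σ → K)).card := by
      refine Finset.card_bij' (fun z _ => Function.update z.1 o z.2)
        (fun x _ => (Function.update x o t, x o)) ?_ ?_ ?_ ?_
      · intro a _; exact Finset.mem_univ _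
      · intro a _; exact Finset.mem_filter.2 ⟨Finset.mem_univ _, by simp⟩
      · rintro ⟨x, y⟩ h
        have : x o = t := (Finset.mem_filter.1 h).2
        subst this
        simp
      · intro x _
        simp
    rw [this]; simp [hq, hk]
  let R : (σ → σ → K) → (σ → K) × K → Prop := fun s z => ∀ i, φ i z.1 + AA o z.1 (s i) = z.2
  let N : (σ → σ → K) → ℕ := fun s => (Z.filter (R s)).card
  have hN : ∀ s, Nat.card {z : (σ → K) × K // z.1 o = t ∧
      ∀ i, φ i z.1 + AA o z.1 (s i) = z.2} = N s := by
    intro s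
    rw [Nat.card_eq_fintype_card, Fintype.card_subtype]
    congr 1
    ext z
    simp [Z, R]
  simp only [hN]
  have hR : ∀ s z, R s z ↔ ∀ i, AA o z.1 (s i) = z.2 - φ i z.1 := by
    intro s z
    refine forall_congr' fun i => ?_
    rw [eq_sub_iff_add_eq, add_comm]
  have h1 : Fintype.card (σ → σ → K) ≤ ∑ s, N s := by
    have h2 : ∑ s, N s = ∑ z ∈ Z, (Finset.univ.filter fun s => R s z).card := by
      simp only [N, Finset.card_filter]
      rw [Finset.sum_comm]
    have h3 : Fintype.card (σ → σ → K) * q ^ k ≤ (∑ s, N s) * q ^ k := by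
      rw [h2, Finset.sum_mul]
      calc Fintype.card (σ → σ → K) * q ^ k = ∑ z ∈ Z, Fintype.card (σ → σ → K) := by
            rw [Finset.sum_const, hZ, smul_eq_mul, mul_comm]
        _ ≤ _ := by
            refine Finset.sum_le_sum fun z _ => ?_
            have := cnt_one o z.1 (fun i => z.2 - φ i z.1)
            rw [Nat.card_eq_fintype_card, Fintype.card_subtype] at this
            simp only [hR]
            exact this
    exact Nat.le_of_mul_le_mul_right h3 hqpos
  have h4 : ∑ s, (N s * N s - N s) ≤ Fintype.card (σ → σ → K) := by
    have h5 : ∀ s, N s * N s - N s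
        = (Z.offDiag.filter fun zz => R s zz.1 ∧ R s zz.2).card := by
      intro s
      rw [← Finset.offDiag_card]
      congr 1
      ext zz
      simp only [Finset.mem_offDiag, Finset.mem_filter]
      tauto
    have h6 : ∑ s, (N s * N s - N s)
        = ∑ zz ∈ Z.offDiag, (Finset.univ.filter fun s => R s zz.1 ∧ R s zz.2).card := by
      simp only [h5, Finset.card_filter]
      rw [Finset.sum_comm]
    have h7 : (∑ s, (N s * N s - N s)) * (q ^ k * q ^ k)
        ≤ Fintype.card (σ → σ → K) * (q ^ k * q ^ k) := by
      rw [h6, Finset.sum_mul]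
      calc _ ≤ ∑ zz ∈ Z.offDiag, Fintype.card (σ → σ → K) := by
            refine Finset.sum_le_sum fun zz hzz => ?_
            obtain ⟨⟨x, y⟩, ⟨x', y'⟩⟩ := zz
            rw [Finset.mem_offDiag] at hzz
            obtain ⟨hz, hz', hne⟩ := hzz
            have hx : x o = t := by simpa [Z] using hz
            have hx' : x' o = t := by simpa [Z] using hz'
            by_cases hxx : x = x'
            · subst hxx
              have : (Finset.univ.filter fun s => R s (x, y) ∧ R s (x, y')) = ∅ := by
                rw [Finset.filter_eq_empty_iff]
                rintro s _ ⟨g1, g2⟩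
                exact hne (Prod.ext rfl ((g1 o).symm.trans (g2 o)))
              rw [this]; simp
            · have := cnt_two o x x' (hx.trans hx'.symm) hxx (fun i => y - φ i x)
                (fun i => y' - φ i x')
              rw [Nat.card_eq_fintype_card, Fintype.card_subtype] at this
              simp only [hR]
              exact this
        _ = Z.offDiag.card * Fintype.card (σ → σ → K) := by rw [Finset.sum_const, smul_eq_mul]
        _ ≤ (q ^ k * q ^ k) * Fintype.card (σ → σ → K) := by
            gcongr
            rw [Finset.offDiag_card, hZ]
            exact Nat.sub_le _ _
        _ = _ := mul_comm _ _
    exact Nat.le_of_mul_le_mul_right h7 (mul_pos hqpos hqpos)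
  have h8 : 6 * ∑ s, N s ≤ 6 * ∑ s, min (N s) 2 + ∑ s, (N s * N s - N s) := by
    rw [Finset.mul_sum, Finset.mul_sum, ← Finset.sum_add_distrib]
    exact Finset.sum_le_sum fun s _ => min_ineq (N s)
  omega

end mean

section conc
variable {σ K : Type*} [Field K] [Fintype K] [Fintype σ] [DecidableEq σ]

abbrev VV (σ K : Type*) (n d : ℕ) : Type _ := (Fin n → σ → K) × (σ → Fin d → K)

noncomputable def psi (o : σ) (n d : ℕ) : VV σ K n d →+ MvPolynomial σ K :=
  AddMonoidHom.mk' (fun v => ∑ j, ∑ i, C (v.1 j i) * (X o ^ (j : ℕ) * (if i = o then 1 else X i))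
    + ∑ i, ∑ j, C (v.2 i j) * X i ^ (j : ℕ)) (by
    intro a b
    simp only [Prod.fst_add, Prod.snd_add, Pi.add_apply, C_add, add_mul, Finset.sum_add_distrib]
    abel)

lemma psi_apply (o : σ) (n d : ℕ) (v : VV σ K n d) : psi o n d v =
    ∑ j, ∑ i, C (v.1 j i) * (X o ^ (j : ℕ) * (if i = o then 1 else X i))
    + ∑ i, ∑ j, C (v.2 i j) * X i ^ (j : ℕ) := rfl

lemma psi_pow (o : σ) (n d : ℕ) (i : σ) (g : Fin d → K) :
    ∃ v, psi o n d v = ∑ j, C (g j) * X i ^ (j : ℕ) := by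
  refine ⟨(0, Pi.single i g), ?_⟩
  rw [psi_apply]
  simp only [Pi.zero_apply, C_0, zero_mul, Finset.sum_const_zero, zero_add]
  rw [Finset.sum_eq_single i]
  · simp
  · intro b _ hb; simp [hb]
  · simp

def wt (o : σ) (d : ℕ) (i : σ) : ℕ := if i = o then 1 else d
def ee (o : σ) (d : ℕ) (i : σ) : ℕ := if i = o then d * d else d

lemma wt_ee (o : σ) (d : ℕ) (i : σ) : wt o d i * ee o d i = d * d := by
  unfold wt ee; split_ifs <;> simp

lemma ee_prod (o : σ) (d : ℕ) (hd : 0 < d) (S : Finset σ) :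
    ∏ i ∈ S, ee o d i ≤ d ^ (Fintype.card σ + 1) := by
  calc ∏ i ∈ S, ee o d i ≤ ∏ i, ee o d i := by
        apply Finset.prod_le_prod_of_subset_of_one_le' (Finset.subset_univ _)
        intro i _ _
        unfold ee; split_ifs
        · exact Nat.mul_pos hd hd
        · exact hd
    _ = ∏ i : σ, ((if i = o then d else 1) * d) := by
        refine Finset.prod_congr rfl fun i _ => ?_
        unfold ee; split_ifs <;> simp
    _ = _ := by
        rw [Finset.prod_mul_distrib, Finset.prod_ite_eq' Finset.univ o]
        simp [pow_succ, mul_comm]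

def Dg (w : σ → ℕ) (L : ℕ) (f : MvPolynomial σ K) : Prop :=
  ∀ α ∈ f.support, ∑ j, w j * α j < L

lemma Dg.add {w : σ → ℕ} {L : ℕ} {f g : MvPolynomial σ K} (hf : Dg w L f) (hg : Dg w L g) :
    Dg w L (f + g) := by
  intro α hα
  rcases Finset.mem_union.1 (support_add hα) with h | h
  · exact hf α h
  · exact hg α h

lemma Dg.sum {w : σ → ℕ} {L : ℕ} {ι : Type*} (s : Finset ι) (f : ι → MvPolynomial σ K)
    (hf : ∀ i ∈ s, Dg w L (f i)) : Dg w L (∑ i ∈ s, f i) :=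
  Finset.sum_induction f (Dg w L) (fun _ _ => Dg.add) (by intro α h; simp at h) hf

lemma Dg.mon {w : σ → ℕ} {L : ℕ} (α : σ →₀ ℕ) (c : K) (h : ∑ j, w j * α j < L) :
    Dg w L (monomial α c) := by
  intro β hβ
  have := support_monomial_subset hβ
  rw [Finset.mem_singleton] at this
  rw [this]; exact h

lemma sum_single (w : σ → ℕ) (i : σ) (n : ℕ) : ∑ j, w j * (Finsupp.single i n) j = w i * n := by
  rw [Finset.sum_eq_single i]
  · simp
  · intro j _ hj; simp [hj.symm]
  · simp

lemma psi_deg (o : σ) (n d : ℕ) (hd : 0 < d) (hnd : n + d ≤ d * d) (v : VV σ K n d) :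
    Dg (wt o d) (d * d) (psi o n d v) := by
  rw [psi_apply]
  apply Dg.add
  · refine Dg.sum _ _ fun j _ => Dg.sum _ _ fun i _ => ?_
    by_cases hi : i = o
    · rw [if_pos hi, mul_one, X_pow_eq_monomial, C_mul_monomial]
      apply Dg.mon
      rw [sum_single]
      have := j.2
      simp [wt]; omega
    · rw [if_neg hi, X_pow_eq_monomial, X, monomial_mul, C_mul_monomial]
      apply Dg.mon
      simp only [Finsupp.add_apply, mul_add, Finset.sum_add_distrib, sum_single]
      have := j.2
      simp [wt, hi]; omega
  · refine Dg.sum _ _ fun i _ => Dg.sum _ _ fun j _ => ?_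
    rw [X_pow_eq_monomial, C_mul_monomial]
    apply Dg.mon
    rw [sum_single]
    have hj := j.2
    have h1 : d * j < d * d := Nat.mul_lt_mul_of_pos_left hj hd
    unfold wt; split_ifs
    · nlinarith
    · exact h1

lemma up_bound (o : σ) (n d : ℕ) (hd : 0 < d) (hnd : n + d ≤ d * d) :
    Nat.card {v : σ → VV σ K n d // ¬ Nat.card {x : σ → K // ∀ i, eval x (psi o n d (v i)) = 0}
      ≤ d ^ (Fintype.card σ + 1)} * Fintype.card K ^ d
      ≤ cc (d ^ (Fintype.card σ + 1)) (Fintype.card σ)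
        * Fintype.card (VV σ K n d) ^ Fintype.card σ := by
  refine le_trans ?_ (bad_bound (psi (K := K) o n d) (wt_ee o d) (ee_prod o d hd)
    (psi_deg o n d hd hnd) (psi_pow o n d) (Fintype.card σ) ∅ (by simp))
  gcongr
  apply card_mono'
  intro v hv hG
  exact hv (good_zeros (wt_ee o d) (ee_prod o d hd) _ (fun i => psi_deg o n d hd hnd (v i)) hG)

def TT (n d : ℕ) (c : Fin n → K) (s : σ → σ → K) : σ → VV σ K n d :=
  fun i => (fun j l => c j * s i l, 0)

lemma eval_TT (o : σ) (n d : ℕ) (c : Fin n → K) (s : σ → σ → K) (ω : σ → VV σ K n d) (i : σ)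
    (x : σ → K) : eval x (psi o n d ((ω + TT n d c s) i))
      = eval x (psi o n d (ω i)) + AA o x (((∑ j, c j * x o ^ (j : ℕ)) • s) i) := by
  rw [Pi.add_apply, map_add, map_add]
  congr 1
  rw [psi_apply]
  simp only [TT, AA, hv, Pi.zero_apply, C_0, zero_mul, Finset.sum_const_zero, add_zero, map_sum,
    map_mul, eval_C, map_pow, eval_X, Pi.smul_apply, smul_eq_mul, Finset.sum_mul]
  rw [Finset.sum_comm]
  refine Finset.sum_congr rfl fun l _ => Finset.sum_congr rfl fun j _ => ?_
  split_ifs <;> simp <;> ring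

lemma low_bound (o : σ) (m d : ℕ) (hm : 0 < m) :
    (Nat.card {v : σ → VV σ K (2 * m) d // ¬ (Fintype.card K : ℝ) / 2 ≤
      (Nat.card {z : (σ → K) × K // ∀ i, eval z.1 (psi o (2 * m) d (v i)) = z.2} : ℝ)} : ℝ)
        * Fintype.card K ^ m
      ≤ (Fintype.card (VV σ K (2 * m) d) : ℝ) ^ Fintype.card σ * (6 * m) ^ (2 * m) := by
  classical
  let N : K → (σ → VV σ K (2 * m) d) → ℕ := fun t ω =>
    Nat.card {z : (σ → K) × K // z.1 o = t ∧ ∀ i, eval z.1 (psi o (2 * m) d (ω i)) = z.2}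
  let c0 : Fin (2 * m) → K := Pi.single ⟨0, by omega⟩ 1
  have hc0 : ∀ t : K, ∑ j, c0 j * t ^ (j : ℕ) = 1 := by
    intro t
    rw [Finset.sum_eq_single ⟨0, by omega⟩]
    · simp [c0]
    · intro b _ hb; simp [c0, hb]
    · simp
  let T0 : (σ → σ → K) →+ (σ → VV σ K (2 * m) d) :=
    AddMonoidHom.mk' (TT (2 * m) d c0) (by
      intro a b
      funext i
      simp only [TT, Pi.add_apply, Prod.mk_add_mk, add_zero]
      congr 1
      funext j l
      simp [mul_add])
  have hT0 : ∀ s, T0 s = TT (2 * m) d c0 s := fun _ => rfl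
  have hN : ∀ c s t ω, N t (ω + TT (2 * m) d c s) = Nat.card {z : (σ → K) × K // z.1 o = t ∧
      ∀ i, eval z.1 (psi o (2 * m) d (ω i))
        + AA o z.1 (((∑ j, c j * t ^ (j : ℕ)) • s) i) = z.2} := by
    intro c s t ω
    simp only [N]
    refine Nat.card_congr (Equiv.subtypeEquivRight fun z => ?_)
    refine and_congr_right fun hz => forall_congr' fun i => ?_
    rw [eval_TT, hz]
  have main := dev_bound (K := K) (Ξ := σ → σ → K) m hm
    (fun t ω => ((min (N t ω) 2 : ℕ) : ℝ)) (fun _ _ => Nat.cast_nonneg _)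
    (fun t ω => by exact_mod_cast min_le_right _ _) (TT (2 * m) d) T0 (by
      intro c s t ω
      rw [hT0, hN, hN, hc0, one_smul]) (by
      intro t ω
      have := mean_bound o t (fun i x => eval x (psi o (2 * m) d (ω i)))
      have h2 : (5 : ℝ) * Fintype.card (σ → σ → K) ≤ 6 * ∑ s : σ → σ → K,
        ((min (N t (ω + T0 s)) 2 : ℕ) : ℝ) := by
        simp only [hT0, hN, hc0, one_smul]
        exact_mod_cast this
      linarith)
  rw [Fintype.card_fun, Nat.cast_pow] at main
  refine le_trans ?_ main
  gcongr
  apply card_mono'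
  intro ω hω
  push Not at hω
  refine lt_of_le_of_lt ?_ hω
  have h3 : ∑ t, N t ω = Nat.card {z : (σ → K) × K // ∀ i, eval z.1 (psi o (2 * m) d (ω i)) = z.2} := by
    simp only [N, Nat.card_eq_fintype_card, Fintype.card_subtype]
    rw [Finset.card_eq_sum_card_fiberwise (f := fun z => z.1 o) (t := Finset.univ) (by simp)]
    refine Finset.sum_congr rfl fun t _ => ?_
    congr 1
    ext z
    simp [and_comm]
  rw [← h3]
  push_cast
  exact Finset.sum_le_sum fun t _ => min_le_left _ _

end conc

section fin
variable {A V : Type*} [Fintype A] [Fintype V] [Nonempty V]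

lemma pull_bound {r : ℕ} (P : (Fin r → V) → Prop) (e : Fin r → A) (he : Function.Injective e) :
    Nat.card {f : A → V // P (f ∘ e)} * Fintype.card V ^ r
      ≤ Nat.card {g // P g} * Fintype.card V ^ Fintype.card A := by
  classical
  have hinj : Function.Injective (fun z : {f : A → V // P (f ∘ e)} × (Fin r → V) =>
      ((⟨z.1.1 ∘ e, z.1.2⟩, Function.extend e z.2 z.1.1) : {g // P g} × (A → V))) := by
    rintro ⟨⟨f, hf⟩, h⟩ ⟨⟨f', hf'⟩, h'⟩ heq
    simp only [Prod.mk.injEq, Subtype.mk.injEq] at heq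
    obtain ⟨h1, h2⟩ := heq
    have hh : h = h' := by
      funext i
      have := congrFun h2 (e i)
      rwa [he.extend_apply, he.extend_apply] at this
    have hff : f = f' := by
      funext a
      by_cases ha : ∃ i, e i = a
      · obtain ⟨i, rfl⟩ := ha
        exact congrFun h1 i
      · have := congrFun h2 a
        rwa [Function.extend_apply' _ _ _ ha, Function.extend_apply' _ _ _ ha] at this
    subst hh; subst hff; rfl
  have := Nat.card_le_card_of_injective _ hinj
  rw [Nat.card_prod, Nat.card_prod] at this
  simpa [Nat.card_eq_fintype_card] using this

lemma union_bound {r : ℕ} (P : (Fin r → V) → Prop) (q c D : ℕ) (hq : 0 < q)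
    (hA : Fintype.card A ^ r = q ^ c)
    (hP : Nat.card {g // P g} * q ^ (c + 1) ≤ D * Fintype.card V ^ r) :
    Nat.card {f : A → V // ∃ e : Fin r → A, Function.Injective e ∧ P (f ∘ e)} * q
      ≤ D * Fintype.card V ^ Fintype.card A := by
  classical
  have hV : 0 < Fintype.card V := Fintype.card_pos
  have h1 : ∀ e : Fin r → A,
      Nat.card {f : A → V // Function.Injective e ∧ P (f ∘ e)} * q ^ (c + 1)
        ≤ D * Fintype.card V ^ Fintype.card A := by
    intro e
    by_cases he : Function.Injective e
    · simp only [he, true_and]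
      have h2 := pull_bound P e he
      have h3 : (Nat.card {f : A → V // P (f ∘ e)} * q ^ (c + 1)) * Fintype.card V ^ r
          ≤ (D * Fintype.card V ^ Fintype.card A) * Fintype.card V ^ r := by
        calc _ = (Nat.card {f : A → V // P (f ∘ e)} * Fintype.card V ^ r) * q ^ (c + 1) := by ring
          _ ≤ (Nat.card {g // P g} * Fintype.card V ^ Fintype.card A) * q ^ (c + 1) :=
            Nat.mul_le_mul_right _ h2
          _ = (Nat.card {g // P g} * q ^ (c + 1)) * Fintype.card V ^ Fintype.card A := by ring
          _ ≤ (D * Fintype.card V ^ r) * Fintype.card V ^ Fintype.card A :=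
            Nat.mul_le_mul_right _ hP
          _ = _ := by ring
      exact Nat.le_of_mul_le_mul_right h3 (pow_pos hV _)
    · simp [he]
  have h4 : Nat.card {f : A → V // ∃ e : Fin r → A, Function.Injective e ∧ P (f ∘ e)}
      ≤ ∑ e : Fin r → A, Nat.card {f : A → V // Function.Injective e ∧ P (f ∘ e)} := by
    have := card_exists_le (Finset.univ : Finset (Fin r → A))
      (fun e (f : A → V) => Function.Injective e ∧ P (f ∘ e))
    simpa using this
  have h5 : (Nat.card {f : A → V // ∃ e : Fin r → A, Function.Injective e ∧ P (f ∘ e)} * q) * q ^ c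
      ≤ (D * Fintype.card V ^ Fintype.card A) * q ^ c := by
    calc _ = Nat.card {f : A → V // ∃ e : Fin r → A, Function.Injective e ∧ P (f ∘ e)}
            * q ^ (c + 1) := by ring
      _ ≤ (∑ e : Fin r → A, Nat.card {f : A → V // Function.Injective e ∧ P (f ∘ e)})
            * q ^ (c + 1) := Nat.mul_le_mul_right _ h4
      _ ≤ ∑ e : Fin r → A, D * Fintype.card V ^ Fintype.card A := by
          rw [Finset.sum_mul]; exact Finset.sum_le_sum fun e _ => h1 e
      _ = _ := by
          rw [Finset.sum_const, Finset.card_univ, Fintype.card_fun, Fintype.card_fin, hA,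
            smul_eq_mul, mul_comm]
  exact Nat.le_of_mul_le_mul_right h5 (pow_pos hq _)

lemma diff_bound {V : Type*} [AddCommGroup V] [Fintype V] {k : ℕ} (P : (Fin k → V) → Prop) :
    Nat.card {g : Fin (k + 1) → V // P (fun i => g i.succ - g 0)}
      ≤ Nat.card {v // P v} * Fintype.card V := by
  have hinj : Function.Injective
      (fun g : {g : Fin (k + 1) → V // P (fun i => g i.succ - g 0)} =>
        ((⟨fun i => g.1 i.succ - g.1 0, g.2⟩, g.1 0) : {v // P v} × V)) := by
    rintro ⟨g, hg⟩ ⟨g', hg'⟩ h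
    simp only [Prod.mk.injEq, Subtype.mk.injEq] at h
    obtain ⟨h1, h2⟩ := h
    apply Subtype.ext
    funext i
    refine Fin.cases h2 (fun j => ?_) i
    have := congrFun h1 j
    rw [h2] at this
    exact sub_left_injective this
  have := Nat.card_le_card_of_injective _ hinj
  rw [Nat.card_prod, Nat.card_eq_fintype_card (α := V)] at this
  exact this

lemma core (k : ℕ) (hk : 0 < k) (d m : ℕ) (hd : d = (k + 1) ^ 2 + 1) (hm : m = k * (k + 1) + 1)
    (K : Type) [Field K] [Fintype K] (o : Fin k)
    (hQ : (6 * m) ^ (2 * m) + cc (d ^ (k + 1)) k < Fintype.card K)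
    (A : Type) [Fintype A] (hA : Fintype.card A = Fintype.card K ^ (k + 1)) :
    ∃ f : A → VV (Fin k) K (2 * m) d,
      (∀ e : Fin k → A, Function.Injective e → (Fintype.card K : ℝ) / 2 ≤
        (Nat.card {z : (Fin k → K) × K // ∀ i, eval z.1 (psi o (2 * m) d (f (e i))) = z.2} : ℝ)) ∧
      (∀ e : Fin (k + 1) → A, Function.Injective e →
        Nat.card {x : Fin k → K // ∀ i : Fin k, eval x (psi o (2 * m) d (f (e i.succ) - f (e 0))) = 0}
          ≤ d ^ (k + 1)) := by
  classical
  have hq : 0 < Fintype.card K := Fintype.card_pos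
  have hdpos : 0 < d := by omega
  have hnd : 2 * m + d ≤ d * d := by
    have h1 : m ≤ d := by rw [hm, hd]; nlinarith
    have h2 : 5 ≤ d := by rw [hd]; nlinarith
    nlinarith
  have hlow := low_bound (K := K) o m d (by omega)
  have hup := up_bound (K := K) o (2 * m) d hdpos hnd
  rw [Fintype.card_fin] at hlow hup
  let P1 : (Fin k → VV (Fin k) K (2 * m) d) → Prop := fun v => ¬ (Fintype.card K : ℝ) / 2 ≤
      (Nat.card {z : (Fin k → K) × K // ∀ i, eval z.1 (psi o (2 * m) d (v i)) = z.2} : ℝ)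
  let P2 : (Fin k → VV (Fin k) K (2 * m) d) → Prop := fun v =>
    ¬ Nat.card {x : Fin k → K // ∀ i, eval x (psi o (2 * m) d (v i)) = 0} ≤ d ^ (k + 1)
  have b1 := union_bound (A := A) P1 (Fintype.card K) (k * (k + 1)) ((6 * m) ^ (2 * m)) hq
    (by rw [hA, ← pow_mul, mul_comm]) (by
      rw [← hm]
      have : (Nat.card {g // P1 g} : ℝ) * Fintype.card K ^ m
        ≤ (6 * m) ^ (2 * m) * (Fintype.card (VV (Fin k) K (2 * m) d) : ℝ) ^ k := by
        rw [mul_comm ((6 * m : ℝ) ^ (2 * m))]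
        exact hlow
      exact_mod_cast this)
  have b2 := union_bound (A := A) (fun g : Fin (k + 1) → VV (Fin k) K (2 * m) d =>
      P2 (fun i => g i.succ - g 0)) (Fintype.card K) ((k + 1) * (k + 1)) (cc (d ^ (k + 1)) k) hq
    (by rw [hA, ← pow_mul]) (by
      rw [show (k + 1) * (k + 1) + 1 = d by rw [hd]; ring]
      calc _ ≤ (Nat.card {v // P2 v} * Fintype.card (VV (Fin k) K (2 * m) d))
              * Fintype.card K ^ d := Nat.mul_le_mul_right _ (diff_bound P2)
        _ = (Nat.card {v // P2 v} * Fintype.card K ^ d)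
              * Fintype.card (VV (Fin k) K (2 * m) d) := by ring
        _ ≤ _ := Nat.mul_le_mul_right _ hup
        _ = _ := by ring)
  have hex : ∃ f : A → VV (Fin k) K (2 * m) d,
      ¬ ((∃ e : Fin k → A, Function.Injective e ∧ P1 (f ∘ e)) ∨
        (∃ e : Fin (k + 1) → A, Function.Injective e ∧
          P2 (fun i => (f ∘ e) i.succ - (f ∘ e) 0))) := by
    by_contra hcon
    push Not at hcon
    have h1 := card_or_le
      (fun f : A → VV (Fin k) K (2 * m) d => ∃ e : Fin k → A, Function.Injective e ∧ P1 (f ∘ e))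
      (fun f => ∃ e : Fin (k + 1) → A, Function.Injective e ∧
          P2 (fun i => (f ∘ e) i.succ - (f ∘ e) 0))
    have h2 : Nat.card {f : A → VV (Fin k) K (2 * m) d //
      (∃ e : Fin k → A, Function.Injective e ∧ P1 (f ∘ e)) ∨
        (∃ e : Fin (k + 1) → A, Function.Injective e ∧
          P2 (fun i => (f ∘ e) i.succ - (f ∘ e) 0))}
        = Fintype.card (VV (Fin k) K (2 * m) d) ^ Fintype.card A := by
      rw [Nat.card_congr (Equiv.subtypeUnivEquiv hcon), Nat.card_eq_fintype_card,
        Fintype.card_fun]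
    rw [h2] at h1
    have h3 := Nat.mul_le_mul_right (Fintype.card K) h1
    rw [add_mul] at h3
    have h4 := h3.trans (add_le_add b1 b2)
    rw [← add_mul, mul_comm] at h4
    have h5 := Nat.le_of_mul_le_mul_right h4 (pow_pos Fintype.card_pos _)
    omega
  obtain ⟨f, hf⟩ := hex
  rw [not_or] at hf
  refine ⟨f, ?_, ?_⟩
  · intro e he
    by_contra hcon
    exact hf.1 ⟨e, he, hcon⟩
  · intro e he
    by_contra hcon
    exact hf.2 ⟨e, he, hcon⟩

end fin
end S6

/-- For every positive integer `k` there exists `Q` such that for every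
prime power `q ≥ Q` the following holds, where `d = (k+1)² + 1` and `n = q^(k+1)`: there is
a bipartite graph on vertex sets `A = B = Fin n` (given by an adjacency relation `E`)
such that every `k`-element subset of `A` has at least `q/2` common neighbours in `B`, and
every `(k+1)`-element subset of `A` has at most `d^(k+1)` common neighbours in `B`. -/
theorem statement_6 (k : ℕ) (hk : 0 < k) (d : ℕ) (hd : d = (k + 1) ^ 2 + 1) :
    ∃ Q : ℕ, ∀ q : ℕ, IsPrimePow q → Q ≤ q →
      ∃ E : Fin (q ^ (k + 1)) → Fin (q ^ (k + 1)) → Prop,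
        (∀ X : Finset (Fin (q ^ (k + 1))), X.card = k →
          (q : ℝ) / 2 ≤
            (Nat.card {b : Fin (q ^ (k + 1)) // ∀ a ∈ X, E a b} : ℝ)) ∧
        (∀ X : Finset (Fin (q ^ (k + 1))), X.card = k + 1 →
          Nat.card {b : Fin (q ^ (k + 1)) // ∀ a ∈ X, E a b} ≤ d ^ (k + 1)) := by
  classical
  refine ⟨(6 * (k * (k + 1) + 1)) ^ (2 * (k * (k + 1) + 1)) + S6.cc (d ^ (k + 1)) k + 1, ?_⟩
  intro q hq hQ
  obtain ⟨p, n, hp, hn, hpq⟩ := hq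
  have : Fact p.Prime := ⟨Nat.prime_iff.2 hp⟩
  have : Fintype (GaloisField p n) := Fintype.ofFinite _
  have hK : Fintype.card (GaloisField p n) = q := by
    rw [← Nat.card_eq_fintype_card, GaloisField.card p n hn.ne', hpq]
  obtain ⟨f, hf1, hf2⟩ := S6.core k hk d _ hd rfl (GaloisField p n) ⟨0, hk⟩
    (by rw [hK]; omega) (Fin (q ^ (k + 1))) (by rw [hK, Fintype.card_fin])
  have β : Fin (q ^ (k + 1)) ≃ (Fin k → GaloisField p n) × GaloisField p n :=
    Fintype.equivOfCardEq (by simp [hK, pow_succ])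
  refine ⟨fun a b => MvPolynomial.eval (β b).1
    (S6.psi ⟨0, hk⟩ (2 * (k * (k + 1) + 1)) d (f a)) = (β b).2, ?_, ?_⟩
  · intro X hX
    have h := hf1 (X.orderEmbOfFin hX) (X.orderEmbOfFin hX).injective
    rw [hK] at h
    refine h.trans (le_of_eq ?_)
    congr 1
    refine Nat.card_congr (Equiv.subtypeEquiv β.symm fun z => ?_)
    simp only [Equiv.apply_symm_apply]
    constructor
    · intro hz a ha
      have : a ∈ Set.range (X.orderEmbOfFin hX) := by
        rw [Finset.range_orderEmbOfFin]; exact ha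
      obtain ⟨i, rfl⟩ := this
      exact hz i
    · intro hz i
      exact hz _ (Finset.orderEmbOfFin_mem X hX i)
  · intro X hX
    refine le_trans ?_ (hf2 (X.orderEmbOfFin hX) (X.orderEmbOfFin hX).injective)
    have hz : ∀ b, (∀ a ∈ X, MvPolynomial.eval (β b).1
        (S6.psi ⟨0, hk⟩ (2 * (k * (k + 1) + 1)) d (f a)) = (β b).2) → ∀ i,
        MvPolynomial.eval (β b).1 (S6.psi ⟨0, hk⟩ (2 * (k * (k + 1) + 1)) d
          (f (X.orderEmbOfFin hX i))) = (β b).2 := fun b hb i =>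
      hb _ (Finset.orderEmbOfFin_mem X hX i)
    refine Nat.card_le_card_of_injective (fun b => ⟨(β b.1).1, fun i => ?_⟩) ?_
    · rw [map_sub, map_sub, hz b.1 b.2, hz b.1 b.2, sub_self]
    · rintro ⟨b, hb⟩ ⟨b', hb'⟩ h
      have h1 : (β b).1 = (β b').1 := congrArg Subtype.val h
      apply Subtype.ext
      apply β.injective
      refine Prod.ext h1 ?_
      rw [← hz b hb 0, ← hz b' hb' 0, h1]
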